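/- arXiv:2306.03165 — 6 statements merged into one kernel-verified Lean document; each statement's English description precedes it below -/
import Mathlib

section
/- Let (Σ,σ) be a compact, connected, continuous Riemannian manifold, M = [t₀,t₁] × Σ, and for each j ∈ ℕ ∪ {∞} let f_j : [t₀,t₁] → (0,∞) be continuous and g_j = −dt² + f_j(t)²σ. Define the time function τ(t) = ∫_{t₀}^{t} 1/f_∞(r) dr. If ∫_{t₀}^{t₁} |f_j − f_∞| dt → 0 as j → ∞ and f_j(t) ≥ f_∞(t) for all t ∈ [t₀,t₁] and all j, then the null distances d̂_{τ,g_j} converge uniformly to d̂_{τ,g_∞} on M × M. -/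
open Set MeasureTheory Filter Topology

namespace NullDistPaper

variable {S : Type*} [PseudoMetricSpace S]

/-- A future-directed causal piece of a curve in the warped product spacetime
`([t₀,t₁] × S, -dt² + f(t,x)² σ)`, parametrized by the time coordinate on `[a,b]`:
the spatial part `x` is continuous, and its σ-length (total variation) over any
subinterval is at most the corresponding integral of `1/f` along the curve. -/
def FutureCausalPiece (f : ℝ → S → ℝ) (x : ℝ → S) (a b : ℝ) : Prop :=
  a ≤ b ∧ ContinuousOn x (Set.Icc a b) ∧
    ∀ c ∈ Set.Icc a b, ∀ d ∈ Set.Icc a b, c ≤ d →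
      eVariationOn x (Set.Icc c d) ≤ ENNReal.ofReal (∫ t in c..d, 1 / f t (x t))

/-- `q` lies in the causal future of `p`, i.e. there is a future-directed causal
curve from `p` to `q`. -/
def FutureRelated (f : ℝ → S → ℝ) (p q : ℝ × S) : Prop :=
  p.1 ≤ q.1 ∧ ∃ x : ℝ → S, x p.1 = p.2 ∧ x q.1 = q.2 ∧ FutureCausalPiece f x p.1 q.1

/-- `q ∈ J^±(p)` : `q` is causally related to `p`. -/
def CausallyRelated (f : ℝ → S → ℝ) (p q : ℝ × S) : Prop :=
  FutureRelated f p q ∨ FutureRelated f q p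

/-- A piecewise causal curve in `[t₀,t₁] × S` from `p` to `q`, recorded by its
breakpoints; consecutive breakpoints are joined by a future- or past-directed
causal piece. -/
structure PiecewiseCausal (f : ℝ → S → ℝ) (t₀ t₁ : ℝ) (p q : ℝ × S) where
  k : ℕ
  hk : 0 < k
  pt : ℕ → ℝ × S
  h0 : pt 0 = p
  hlast : pt k = q
  hstrip : ∀ i ≤ k, (pt i).1 ∈ Set.Icc t₀ t₁
  piece : ∀ i < k, CausallyRelated f (pt i) (pt (i + 1))

/-- The null length of a piecewise causal curve with respect to the
time function `τ`. -/
noncomputable def nullLength (τ : ℝ × S → ℝ) {f : ℝ → S → ℝ} {t₀ t₁ : ℝ} {p q : ℝ × S}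
    (γ : PiecewiseCausal f t₀ t₁ p q) : ℝ :=
  ∑ i ∈ Finset.range γ.k, |τ (γ.pt (i + 1)) - τ (γ.pt i)|

/-- The null distance on `[t₀,t₁] × S` for the warped product `-dt² + f(t,x)²σ`
and the time function `τ`. -/
noncomputable def nullDist (f : ℝ → S → ℝ) (τ : ℝ × S → ℝ) (t₀ t₁ : ℝ) (p q : ℝ × S) : ℝ :=
  sInf {L : ℝ | ∃ γ : PiecewiseCausal f t₀ t₁ p q, L = nullLength τ γ}

/-- Warping function depending only on the time coordinate. -/
def tWarp (f : ℝ → ℝ) : ℝ → S → ℝ := fun t _ => f t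

/-- The metric of `S` is intrinsic (a length metric): any two points can be
joined by continuous curves of length arbitrarily close to their distance.
This encodes that `(S, d)` comes from a (continuous) Riemannian metric. -/
def IsLengthSpace (S : Type*) [PseudoMetricSpace S] : Prop :=
  ∀ x y : S, ∀ ε > 0, ∃ γ : ℝ → S, γ 0 = x ∧ γ 1 = y ∧ ContinuousOn γ (Set.Icc 0 1) ∧
    eVariationOn γ (Set.Icc 0 1) ≤ ENNReal.ofReal (dist x y + ε)

end NullDistPaper

section Helpers

open NullDistPaper

theorem ndp_var_le {S : Type*} [PseudoMetricSpace S] (x : ℝ → S) (F : ℝ → ℝ) (a b : ℝ)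
    (hab : a ≤ b)
    (h : ∀ s ∈ Icc a b, ∀ t ∈ Icc a b, s ≤ t → dist (x s) (x t) ≤ F t - F s) :
    eVariationOn x (Icc a b) ≤ ENNReal.ofReal (F b - F a) := by
  have hF : MonotoneOn F (Icc a b) := by
    intro s hs t ht hst
    have := h s hs t ht hst
    have h2 : 0 ≤ dist (x s) (x t) := dist_nonneg
    linarith
  have h1 := hF.eVariationOn_eq (left_mem_Icc.2 hab) (right_mem_Icc.2 hab)
  rw [inter_self] at h1
  rw [← h1]
  apply iSup_le
  rintro ⟨n, u, hu, us⟩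
  refine le_trans ?_ (eVariationOn.sum_le (f := F) (n := n) hu us)
  apply Finset.sum_le_sum
  intro i _
  rw [edist_dist, edist_dist]
  apply ENNReal.ofReal_le_ofReal
  have := h (u i) (us i) (u (i+1)) (us (i+1)) (hu (Nat.le_succ i))
  rw [dist_comm, Real.dist_eq]
  exact this.trans (le_abs_self _)

theorem ndp_arclen_aux {S : Type*} [MetricSpace S] (γ : ℝ → S) (hγ : Continuous γ) (L : ℝ)
    (hL : eVariationOn γ (Icc 0 1) ≤ ENNReal.ofReal L) (hL0 : 0 ≤ L) :
    ∃ c : ℝ → S, LipschitzWith 1 c ∧ c 0 = γ 0 ∧ ∀ C, L ≤ C → c C = γ 1 := by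
  set v : ℝ → ℝ := fun s => (eVariationOn γ (Icc 0 s)).toReal with hv
  have hfin : ∀ s ≤ 1, eVariationOn γ (Icc 0 s) ≠ ⊤ := by
    intro s hs
    refine ne_top_of_le_ne_top ENNReal.ofReal_ne_top ((eVariationOn.mono γ ?_).trans hL)
    exact Icc_subset_Icc_right hs
  have hvd : ∀ s s', 0 ≤ s → s ≤ s' → s' ≤ 1 → v s + dist (γ s) (γ s') ≤ v s' := by
    intro s s' h0 hs h1
    have e := eVariationOn.Icc_add_Icc γ (s := univ) h0 hs (mem_univ _)
    simp only [univ_inter] at e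
    have hle : eVariationOn γ (Icc 0 s) + edist (γ s) (γ s') ≤ eVariationOn γ (Icc 0 s') := by
      rw [← e]
      gcongr
      exact eVariationOn.edist_le γ (left_mem_Icc.2 hs) (right_mem_Icc.2 hs)
    have := ENNReal.toReal_mono (hfin s' h1) hle
    rw [ENNReal.toReal_add (hfin s (hs.trans h1)) (edist_ne_top _ _), ← dist_edist] at this
    exact this
  have hv1 : v 1 ≤ L := by
    have := ENNReal.toReal_mono ENNReal.ofReal_ne_top hL
    rwa [ENNReal.toReal_ofReal hL0] at this
  have hv0 : ∀ s, 0 ≤ v s := fun s => ENNReal.toReal_nonneg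
  set A : ℝ → Set ℝ := fun a => {s | s = 0 ∨ (s ∈ Icc (0:ℝ) 1 ∧ v s ≤ a)} with hA
  have hAne : ∀ a, (A a).Nonempty := fun a => ⟨0, Or.inl rfl⟩
  have hA01 : ∀ a, A a ⊆ Icc 0 1 := by
    rintro a s (rfl | h)
    · simp
    · exact h.1
  have hAb : ∀ a, BddAbove (A a) := fun a => bddAbove_Icc.mono (hA01 a)
  set φ : ℝ → ℝ := fun a => sSup (A a) with hφ
  have hφ01 : ∀ a, φ a ∈ Icc (0:ℝ) 1 := fun a =>
    ⟨le_csSup (hAb a) (Or.inl rfl), csSup_le (hAne a) fun s hs => (hA01 a hs).2⟩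
  have key : ∀ a b, a ≤ b → dist (γ (φ a)) (γ (φ b)) ≤ b - a := by
    intro a b hab
    have hmono : φ a ≤ φ b := by
      apply csSup_le_csSup (hAb b) (hAne a)
      rintro s (h | h)
      · exact Or.inl h
      · exact Or.inr ⟨h.1, h.2.trans hab⟩
    rcases hmono.eq_or_lt with h | hlt
    · rw [h, dist_self]; linarith
    have c1 : ∀ s' ∈ Ioo (φ a) (φ b), dist (γ s') (γ (φ b)) ≤ b - a := by
      intro s' hs'
      by_contra hcon
      push Not at hcon
      have hopen : IsOpen {z | b - a < dist (γ s') (γ z)} :=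
        isOpen_lt continuous_const (continuous_const.dist hγ)
      have hopen2 := hopen.inter (isOpen_Ioi (a := s'))
      obtain ⟨z, ⟨hz1, hz2⟩, hz3⟩ := mem_closure_iff.1 (csSup_mem_closure (hAne b) (hAb b)) _ hopen2
        ⟨hcon, hs'.2⟩
      simp only [mem_setOf_eq, mem_Ioi] at hz1 hz2
      have hs0 : 0 ≤ s' := (hφ01 a).1.trans hs'.1.le
      have hs1 : s' ≤ 1 := hs'.2.le.trans (hφ01 b).2
      have hva : a < v s' := by
        by_contra hc
        push Not at hc
        exact absurd (le_csSup (hAb a) (show s' ∈ A a from Or.inr ⟨⟨hs0, hs1⟩, hc⟩)) (not_le.2 hs'.1)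
      rcases hz3 with h | h
      · linarith
      · have := hvd s' z hs0 hz2.le h.1.2
        linarith [h.2]
    have hcl : IsClosed {z | dist (γ z) (γ (φ b)) ≤ b - a} :=
      isClosed_le (hγ.dist continuous_const) continuous_const
    have : φ a ∈ closure (Ioo (φ a) (φ b)) := by
      rw [closure_Ioo hlt.ne]; exact left_mem_Icc.2 hlt.le
    exact hcl.closure_subset_iff.2 c1 this
  have hneg : ∀ a < 0, φ a = 0 := by
    intro a ha
    apply le_antisymm _ (hφ01 a).1
    apply csSup_le (hAne a)
    rintro s (h | h)
    · exact h.le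
    · linarith [h.2, hv0 s]
  refine ⟨fun a => γ (φ a), ?_, ?_, ?_⟩
  · apply LipschitzWith.of_dist_le_mul
    intro a b
    rw [NNReal.coe_one, one_mul, Real.dist_eq]
    rcases le_total a b with h | h
    · rw [abs_sub_comm]; exact (key a b h).trans (le_abs_self _)
    · rw [dist_comm]; exact (key b a h).trans (le_abs_self _)
  · have : dist (γ 0) (γ (φ 0)) ≤ 0 := by
      apply le_of_forall_pos_le_add
      intro e he
      have := key (-e) 0 (by linarith)
      rw [hneg (-e) (by linarith)] at this
      linarith
    exact (dist_le_zero.1 this).symm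
  · intro C hC
    have : φ C = 1 := le_antisymm (hφ01 C).2
      (le_csSup (hAb C) (Or.inr ⟨right_mem_Icc.2 zero_le_one, hv1.trans hC⟩))
    simp only [this]

theorem ndp_arclen {S : Type*} [MetricSpace S] (hLS : IsLengthSpace S) (x y : S) (ε : ℝ)
    (hε : 0 < ε) :
    ∃ c : ℝ → S, LipschitzWith 1 c ∧ c 0 = x ∧ ∀ C, dist x y + ε ≤ C → c C = y := by
  obtain ⟨γ, h0, h1, hc, hv⟩ := hLS x y ε hε
  have heq : EqOn (IccExtend (zero_le_one (α := ℝ)) ((Icc 0 1).restrict γ)) γ (Icc 0 1) := by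
    intro s hs
    rw [IccExtend_of_mem _ _ hs]; rfl
  have := ndp_arclen_aux (IccExtend (zero_le_one (α := ℝ)) ((Icc 0 1).restrict γ))
    ((continuousOn_iff_continuous_restrict.1 hc).Icc_extend') (dist x y + ε)
    (by rw [eVariationOn.eq_of_eqOn heq]; exact hv) (by positivity)
  rwa [heq (by simp), heq (by simp), h0, h1] at this

theorem ndp_int {t₀ t₁ : ℝ} {h : ℝ → ℝ} (hc : ContinuousOn h (Icc t₀ t₁))
    (hp : ∀ t ∈ Icc t₀ t₁, 0 < h t) {c d : ℝ} (hcc : c ∈ Icc t₀ t₁) (hd : d ∈ Icc t₀ t₁) :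
    IntervalIntegrable (fun t => 1 / h t) volume c d := by
  apply ContinuousOn.intervalIntegrable
  have hs : uIcc c d ⊆ Icc t₀ t₁ := by
    exact uIcc_subset_Icc hcc hd
  exact continuousOn_const.div (hc.mono hs) fun t ht => (hp t (hs ht)).ne'

theorem ndp_causal {S : Type*} [MetricSpace S] {t₀ t₁ : ℝ} {h : ℝ → ℝ}
    (hc : ContinuousOn h (Icc t₀ t₁)) (hp : ∀ t ∈ Icc t₀ t₁, 0 < h t)
    (c : ℝ → S) (hL : LipschitzWith 1 c) (a : ℝ) {u w : ℝ} (hu : u ∈ Icc t₀ t₁)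
    (hw : w ∈ Icc t₀ t₁) :
    CausallyRelated (tWarp h) (u, c a)
      (w, c (a + |(∫ r in t₀..w, 1 / h r) - ∫ r in t₀..u, 1 / h r|)) := by
  have ht : t₀ ∈ Icc t₀ t₁ := left_mem_Icc.2 (hu.1.trans hu.2)
  set F : ℝ → ℝ := fun t => ∫ r in t₀..t, 1 / h r with hF
  have hsub : ∀ s ∈ Icc t₀ t₁, ∀ t ∈ Icc t₀ t₁, ∫ r in s..t, 1 / h r = F t - F s := by
    intro s hs t ht'
    rw [hF]
    simp only
    rw [intervalIntegral.integral_interval_sub_left (ndp_int hc hp ht ht') (ndp_int hc hp ht hs)]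
  have hmono : ∀ s ∈ Icc t₀ t₁, ∀ t ∈ Icc t₀ t₁, s ≤ t → F s ≤ F t := by
    intro s hs t ht' hst
    rw [← sub_nonneg, ← hsub s hs t ht']
    apply intervalIntegral.integral_nonneg hst
    intro r hr
    exact (one_div_pos.2 (hp r ⟨hs.1.trans hr.1, hr.2.trans ht'.2⟩)).le
  have hFc : ContinuousOn F (Icc t₀ t₁) := by
    have := intervalIntegral.continuousOn_primitive_interval'
      (ndp_int hc hp ht (right_mem_Icc.2 (hu.1.trans hu.2))) left_mem_uIcc
    rwa [uIcc_of_le (hu.1.trans hu.2)] at this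
  have main : ∀ (x : ℝ → S) (a b : ℝ), a ∈ Icc t₀ t₁ → b ∈ Icc t₀ t₁ → a ≤ b →
      ContinuousOn x (Icc a b) → (∀ s t, dist (x s) (x t) ≤ |F s - F t|) →
      FutureCausalPiece (tWarp h) x a b := by
    intro x a b ha hb hab hxc hx
    refine ⟨hab, hxc, ?_⟩
    intro c hcc d hd hcd
    have hc' : c ∈ Icc t₀ t₁ := ⟨ha.1.trans hcc.1, hcc.2.trans hb.2⟩
    have hd' : d ∈ Icc t₀ t₁ := ⟨ha.1.trans hd.1, hd.2.trans hb.2⟩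
    simp only [tWarp]
    rw [hsub c hc' d hd']
    apply ndp_var_le x F c d hcd
    intro s hs t ht' hst
    have := hmono s ⟨hc'.1.trans hs.1, hs.2.trans hd'.2⟩ t ⟨hc'.1.trans ht'.1, ht'.2.trans hd'.2⟩ hst
    have h2 := hx s t
    rwa [abs_sub_comm, abs_of_nonneg (by linarith)] at h2
  have hLd : ∀ s t, dist (c s) (c t) ≤ |s - t| := by
    intro s t
    have := hL.dist_le_mul s t
    rwa [NNReal.coe_one, one_mul, Real.dist_eq] at this
  rcases le_total u w with huw | huw
  · left
    have hm := hmono u hu w hw huw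
    refine ⟨huw, fun t => c (a + (F t - F u)), by simp, ?_, ?_⟩
    · simp only
      rw [abs_of_nonneg (by linarith)]
    · apply main _ _ _ hu hw huw
      · refine hL.continuous.comp_continuousOn ?_
        exact continuousOn_const.add ((hFc.mono (Icc_subset_Icc hu.1 hw.2)).sub continuousOn_const)
      · intro s t
        refine (hLd _ _).trans (le_of_eq ?_)
        congr 1; ring
  · right
    have hm := hmono w hw u hu huw
    refine ⟨huw, fun t => c (a + (F u - F t)), ?_, by simp, ?_⟩
    · simp only
      rw [abs_sub_comm, abs_of_nonneg (by linarith)]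
    · apply main _ _ _ hw hu huw
      · refine hL.continuous.comp_continuousOn ?_
        exact continuousOn_const.add (continuousOn_const.sub (hFc.mono (Icc_subset_Icc hw.1 hu.2)))
      · intro s t
        refine (hLd _ _).trans (le_of_eq ?_)
        rw [abs_sub_comm]
        congr 1; ring

/-- zigzag walk -/
noncomputable def ndpWalk (t t' v : ℝ) (i : ℕ) : ℝ :=
  if i = 0 then t else if i % 2 = 1 then t' else v

theorem ndp_walk_sum (H : ℝ → ℝ) (t t' v : ℝ) (n : ℕ) :
    ∑ i ∈ Finset.range (2 * n + 1), |H (ndpWalk t t' v (i+1)) - H (ndpWalk t t' v i)|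
      = |H t' - H t| + 2 * n * |H v - H t'| := by
  induction n with
  | zero => simp [ndpWalk]
  | succ n ih =>
    rw [show 2 * (n + 1) + 1 = (2 * n + 1) + 1 + 1 by ring, Finset.sum_range_succ,
      Finset.sum_range_succ, ih]
    have e1 : ndpWalk t t' v (2 * n + 1) = t' := by
      unfold ndpWalk; rw [if_neg (by omega), if_pos (by omega)]
    have e2 : ndpWalk t t' v (2 * n + 1 + 1) = v := by
      unfold ndpWalk; rw [if_neg (by omega), if_neg (by omega)]
    have e3 : ndpWalk t t' v (2 * n + 1 + 1 + 1) = t' := by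
      unfold ndpWalk; rw [if_neg (by omega), if_pos (by omega)]
    rw [e1, e2, e3, abs_sub_comm (H t') (H v)]
    push_cast
    ring

theorem ndp_lower {S : Type*} [MetricSpace S] {t₀ t₁ : ℝ} {g h : ℝ → ℝ}
    (hc : ContinuousOn h (Icc t₀ t₁)) (hp : ∀ t ∈ Icc t₀ t₁, 0 < h t)
    (gc : ContinuousOn g (Icc t₀ t₁)) (gp : ∀ t ∈ Icc t₀ t₁, 0 < g t)
    (hgh : ∀ t ∈ Icc t₀ t₁, g t ≤ h t)
    (τ : ℝ × S → ℝ) (hτ : ∀ p : ℝ × S, τ p = ∫ r in t₀..p.1, 1 / g r)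
    (p q : ℝ × S) (γ : PiecewiseCausal (tWarp h) t₀ t₁ p q) :
    max |τ p - τ q| (dist p.2 q.2) ≤ nullLength τ γ := by
  have step : ∀ p q : ℝ × S, p.1 ∈ Icc t₀ t₁ → q.1 ∈ Icc t₀ t₁ → FutureRelated (tWarp h) p q →
      dist p.2 q.2 ≤ |τ q - τ p| := by
    rintro p q hp1 hq1 ⟨hle, x, hx0, hx1, -, -, hx⟩
    have ht : t₀ ∈ Icc t₀ t₁ := left_mem_Icc.2 (hp1.1.trans hp1.2)
    have h1 := hx p.1 (left_mem_Icc.2 hle) q.1 (right_mem_Icc.2 hle) hle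
    have h2 := (eVariationOn.edist_le x (left_mem_Icc.2 hle) (right_mem_Icc.2 hle)).trans h1
    rw [hx0, hx1, edist_dist] at h2
    have h0 : ∀ t ∈ Icc p.1 q.1, t ∈ Icc t₀ t₁ := fun t ht => ⟨hp1.1.trans ht.1, ht.2.trans hq1.2⟩
    have hnn : 0 ≤ ∫ t in p.1..q.1, 1 / tWarp h t (x t) :=
      intervalIntegral.integral_nonneg hle fun t ht => (one_div_pos.2 (hp t (h0 t ht))).le
    have h3 := (ENNReal.ofReal_le_ofReal_iff hnn).1 h2
    have h4 : ∫ t in p.1..q.1, 1 / tWarp h t (x t) ≤ ∫ t in p.1..q.1, 1 / g t := by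
      apply intervalIntegral.integral_mono_on hle (ndp_int hc hp hp1 hq1) (ndp_int gc gp hp1 hq1)
      intro t ht
      exact one_div_le_one_div_of_le (gp t (h0 t ht)) (hgh t (h0 t ht))
    have h5 : ∫ t in p.1..q.1, 1 / g t = τ q - τ p := by
      rw [hτ, hτ, intervalIntegral.integral_interval_sub_left (ndp_int gc gp ht hq1)
        (ndp_int gc gp ht hp1)]
    rw [h5] at h4
    exact (h3.trans h4).trans (le_abs_self _)
  unfold nullLength
  apply max_le
  · have := dist_le_range_sum_dist (fun i => τ (γ.pt i)) γ.k
    simp only [γ.h0, γ.hlast, Real.dist_eq] at this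
    refine this.trans (le_of_eq ?_)
    apply Finset.sum_congr rfl
    intro i _
    rw [abs_sub_comm]
  · have := dist_le_range_sum_dist (fun i => (γ.pt i).2) γ.k
    simp only [γ.h0, γ.hlast] at this
    refine this.trans ?_
    apply Finset.sum_le_sum
    intro i hi
    have hi' := Finset.mem_range.1 hi
    rcases γ.piece i hi' with hh | hh
    · exact step _ _ (γ.hstrip i hi'.le) (γ.hstrip (i+1) hi') hh
    · rw [dist_comm, abs_sub_comm]
      exact step _ _ (γ.hstrip (i+1) hi') (γ.hstrip i hi'.le) hh

theorem ndp_upper {S : Type*} [MetricSpace S] (hLS : IsLengthSpace S) {t₀ t₁ : ℝ} {g h : ℝ → ℝ}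
    (hc : ContinuousOn h (Icc t₀ t₁)) (hp : ∀ t ∈ Icc t₀ t₁, 0 < h t)
    (gc : ContinuousOn g (Icc t₀ t₁)) (gp : ∀ t ∈ Icc t₀ t₁, 0 < g t)
    (τ : ℝ × S → ℝ) (hτ : ∀ p : ℝ × S, τ p = ∫ r in t₀..p.1, 1 / g r)
    (ε η T B : ℝ) (hε : 0 < ε) (n : ℕ)
    (hT : T = ∫ r in t₀..t₁, 1 / g r) (hTpos : 0 < T)
    (hB : ∀ x y : S, dist x y ≤ B) (hB0 : 0 ≤ B)
    (hn : B + T + ε ≤ n * T) (hη : (2 * n + 1) * η ≤ ε / 2)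
    (hclose : ∀ u ∈ Icc t₀ t₁, ∀ w ∈ Icc t₀ t₁,
      |(∫ r in t₀..w, 1 / g r) - ∫ r in t₀..u, 1 / g r| - η ≤
      |(∫ r in t₀..w, 1 / h r) - ∫ r in t₀..u, 1 / h r|)
    (p q : ℝ × S) (hp1 : p.1 ∈ Icc t₀ t₁) (hq1 : q.1 ∈ Icc t₀ t₁) :
    ∃ γ : PiecewiseCausal (tWarp h) t₀ t₁ p q,
      nullLength τ γ ≤ max |τ p - τ q| (dist p.2 q.2) + ε := by
  have hle := hp1.1.trans hp1.2
  have ht : t₀ ∈ Icc t₀ t₁ := left_mem_Icc.2 hle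
  set G : ℝ → ℝ := fun t => ∫ r in t₀..t, 1 / g r with hG
  set F : ℝ → ℝ := fun t => ∫ r in t₀..t, 1 / h r with hF
  have hGc : ContinuousOn G (Icc t₀ t₁) := by
    have := intervalIntegral.continuousOn_primitive_interval'
      (ndp_int gc gp ht (right_mem_Icc.2 hle)) left_mem_uIcc
    rwa [uIcc_of_le hle] at this
  have hG0 : G t₀ = 0 := by simp [hG]
  have hG1 : G t₁ = T := hT.symm
  have hivt : ∀ s ∈ Icc 0 T, ∃ v ∈ Icc t₀ t₁, G v = s := by
    intro s hs
    have := intermediate_value_Icc hle hGc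
    rw [hG0, hG1] at this
    exact this hs
  have hGm : ∀ t ∈ Icc t₀ t₁, G t ∈ Icc 0 T := by
    intro t htt
    constructor
    · exact intervalIntegral.integral_nonneg htt.1 fun r hr =>
        (one_div_pos.2 (gp r ⟨hr.1, hr.2.trans htt.2⟩)).le
    · rw [← sub_nonneg, hT]
      simp only [hG]
      rw [intervalIntegral.integral_interval_sub_left (ndp_int gc gp ht (right_mem_Icc.2 hle))
        (ndp_int gc gp ht htt)]
      exact intervalIntegral.integral_nonneg htt.2 fun r hr =>
        (one_div_pos.2 (gp r ⟨htt.1.trans hr.1, hr.2⟩)).le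
  set Δ := |G q.1 - G p.1| with hΔ
  set D := dist p.2 q.2 with hD
  have hτΔ : |τ p - τ q| = Δ := by rw [hτ, hτ, abs_sub_comm]
  rw [hτΔ]
  have hΔT : Δ ≤ T := by
    have h1 := hGm _ hp1
    have h2 := hGm _ hq1
    rw [hΔ, abs_le]; constructor <;> linarith [h1.1, h1.2, h2.1, h2.2]
  have hD0 : 0 ≤ D := dist_nonneg
  have hΔ0 : 0 ≤ Δ := abs_nonneg _
  have hn0 : (0:ℝ) < n := by
    by_contra hcon
    push Not at hcon
    have : (n:ℝ) * T ≤ 0 := mul_nonpos_of_nonpos_of_nonneg hcon hTpos.le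
    linarith
  set L := max Δ D + ε with hL
  have hLΔ : Δ + ε ≤ L := by rw [hL]; gcongr; exact le_max_left _ _
  have hLD : D + ε ≤ L := by rw [hL]; gcongr; exact le_max_right _ _
  have hLB : L ≤ B + T + ε := by
    rw [hL]; gcongr
    exact max_le (by linarith) (by linarith [hB p.2 q.2])
  set δ := (L - Δ) / (2 * n) with hδ
  have hδ0 : 0 ≤ δ := by apply div_nonneg <;> linarith
  have hδT : δ ≤ T / 2 := by
    rw [hδ, div_le_iff₀ (by linarith)]
    linarith
  have hδn : 2 * n * δ = L - Δ := by rw [hδ]; field_simp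
  obtain ⟨v, hv, hvG⟩ : ∃ v ∈ Icc t₀ t₁, |G v - G q.1| = δ := by
    have h2 := hGm _ hq1
    rcases le_total (G q.1) (T / 2) with hc | hc
    · obtain ⟨v, hv, e⟩ := hivt (G q.1 + δ) ⟨by linarith [h2.1], by linarith⟩
      exact ⟨v, hv, by rw [e, add_sub_cancel_left, abs_of_nonneg hδ0]⟩
    · obtain ⟨v, hv, e⟩ := hivt (G q.1 - δ) ⟨by linarith, by linarith [h2.2]⟩
      exact ⟨v, hv, by rw [e, sub_sub_cancel_left, abs_neg, abs_of_nonneg hδ0]⟩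
  obtain ⟨c, hcL, hc0, hc1⟩ := ndp_arclen hLS p.2 q.2 (ε / 2) (by linarith)
  set u := ndpWalk p.1 q.1 v with hu
  have hus : ∀ i, u i ∈ Icc t₀ t₁ := by
    intro i
    rw [hu]; unfold ndpWalk
    split_ifs <;> assumption
  set A : ℕ → ℝ := fun i => ∑ l ∈ Finset.range i, |F (u (l+1)) - F (u l)| with hA
  have hsumF : A (2 * n + 1) = |F q.1 - F p.1| + 2 * n * |F v - F q.1| := ndp_walk_sum F _ _ _ n
  have hAge : D + ε / 2 ≤ A (2 * n + 1) := by
    rw [hsumF]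
    have h1 : Δ - η ≤ |F q.1 - F p.1| := hclose _ hp1 _ hq1
    have h2 : δ - η ≤ |F v - F q.1| := by
      have := hclose _ hq1 _ hv
      rw [← hvG]; exact this
    have h3 : 2 * n * (δ - η) ≤ 2 * n * |F v - F q.1| := by gcongr
    linarith
  have hulast : u (2 * n + 1) = q.1 := by
    rw [hu]; unfold ndpWalk; rw [if_neg (by omega), if_pos (by omega)]
  refine ⟨⟨2 * n + 1, by omega, fun i => (u i, c (A i)), ?_, ?_, fun i _ => hus i, ?_⟩, ?_⟩
  · simp [hA, hc0, hu, ndpWalk]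
  · rw [hulast, hc1 _ hAge]
  · intro i _
    have := ndp_causal hc hp c hcL (A i) (hus i) (hus (i+1))
    have hAs : A (i+1) = A i + |F (u (i+1)) - F (u i)| := Finset.sum_range_succ _ _
    simp only [hAs]
    exact this
  · unfold nullLength
    have := ndp_walk_sum G p.1 q.1 v n
    simp only [hτ]
    refine le_of_eq (this.trans ?_)
    rw [hvG, hδn]
    ring

end Helpers

open NullDistPaper Set Filter

/-- **Theorem 1.1 (`thm-MainTheorem tau`).**
Let `(Σ,σ)` be a compact, connected (continuous Riemannian, i.e. length) metric
space, `M = [t₀,t₁] × Σ`, `fⱼ : [t₀,t₁] → (0,∞)` continuous and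
`gⱼ = -dt² + fⱼ(t)²σ` for `j ∈ ℕ ∪ {∞}`.  With the time function
`τ(t) = ∫_{t₀}^t 1/f_∞(r) dr`, if `∫ |fⱼ - f_∞| dt → 0` and `fⱼ ≥ f_∞` on
`[t₀,t₁]`, then the null distances `d̂_{τ,gⱼ}` converge uniformly to
`d̂_{τ,g_∞}` on `M × M`. -/
theorem nullDist_uniform_convergence_of_L1_and_lower_bound_tau
    {S : Type*} [MetricSpace S] [CompactSpace S] [ConnectedSpace S]
    (hLS : IsLengthSpace S)
    (t₀ t₁ : ℝ) (hle : t₀ ≤ t₁)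
    (f : ℕ → ℝ → ℝ) (finf : ℝ → ℝ)
    (hfc : ∀ j, ContinuousOn (f j) (Set.Icc t₀ t₁))
    (hfinfc : ContinuousOn finf (Set.Icc t₀ t₁))
    (hfpos : ∀ j, ∀ t ∈ Set.Icc t₀ t₁, 0 < f j t)
    (hfinfpos : ∀ t ∈ Set.Icc t₀ t₁, 0 < finf t)
    (τ : ℝ × S → ℝ) (hτ : ∀ p : ℝ × S, τ p = ∫ r in t₀..p.1, 1 / finf r)
    (hL1 : Tendsto (fun j => ∫ t in t₀..t₁, |f j t - finf t|) atTop (nhds 0))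
    (hlower : ∀ j, ∀ t ∈ Set.Icc t₀ t₁, finf t ≤ f j t) :
    ∀ ε > 0, ∃ N : ℕ, ∀ j ≥ N, ∀ p q : ℝ × S,
      p.1 ∈ Set.Icc t₀ t₁ → q.1 ∈ Set.Icc t₀ t₁ →
      |nullDist (tWarp (f j)) τ t₀ t₁ p q - nullDist (tWarp finf) τ t₀ t₁ p q| ≤ ε := by
  intro ε hε
  rcases hle.eq_or_lt with heq | hlt
  · subst heq
    have hz : ∀ (h : ℝ → ℝ) (p q : ℝ × S), nullDist (tWarp h) τ t₀ t₀ p q = 0 := by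
      intro h p q
      have hl : ∀ γ : PiecewiseCausal (tWarp h) t₀ t₀ p q, nullLength τ γ = 0 := by
        intro γ
        apply Finset.sum_eq_zero
        intro i hi
        have hi' := Finset.mem_range.1 hi
        have h1 := γ.hstrip i hi'.le
        have h2 := γ.hstrip (i+1) hi'
        rw [Icc_self, mem_singleton_iff] at h1 h2
        rw [hτ, hτ, h1, h2, sub_self, abs_zero]
      apply le_antisymm
      · apply Real.sInf_nonpos
        rintro L ⟨γ, rfl⟩
        exact (hl γ).le
      · apply Real.sInf_nonneg
        rintro L ⟨γ, rfl⟩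
        exact (hl γ).ge
    refine ⟨0, fun j _ p q _ _ => ?_⟩
    rw [hz, hz, sub_self, abs_zero]
    exact hε.le
  have ht₀ : t₀ ∈ Icc t₀ t₁ := left_mem_Icc.2 hle
  have ht₁ : t₁ ∈ Icc t₀ t₁ := right_mem_Icc.2 hle
  set T := ∫ r in t₀..t₁, 1 / finf r with hT
  have hTpos : 0 < T := by
    apply intervalIntegral.intervalIntegral_pos_of_pos_on (ndp_int hfinfc hfinfpos ht₀ ht₁) _ hlt
    intro t ht
    exact one_div_pos.2 (hfinfpos t (Ioo_subset_Icc_self ht))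
  obtain ⟨B, hB0, hB⟩ : ∃ B : ℝ, 0 ≤ B ∧ ∀ x y : S, dist x y ≤ B :=
    ⟨Metric.diam (univ : Set S), Metric.diam_nonneg, fun x y =>
      Metric.dist_le_diam_of_mem isCompact_univ.isBounded (mem_univ _) (mem_univ _)⟩
  obtain ⟨n, hn⟩ : ∃ n : ℕ, B + T + ε ≤ n * T := by
    obtain ⟨n, hn⟩ := exists_nat_ge ((B + T + ε) / T)
    exact ⟨n, by rwa [div_le_iff₀ hTpos] at hn⟩
  obtain ⟨m, hm0, hm⟩ : ∃ m : ℝ, 0 < m ∧ ∀ t ∈ Icc t₀ t₁, m ≤ finf t := by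
    obtain ⟨s, hs, hmin⟩ := isCompact_Icc.exists_isMinOn ⟨t₀, ht₀⟩ hfinfc
    exact ⟨finf s, hfinfpos s hs, fun t ht => hmin ht⟩
  set η := ε / 2 / (2 * n + 1) with hηd
  have hη0 : 0 < η := by positivity
  have hη : (2 * n + 1) * η ≤ ε / 2 := by rw [hηd]; field_simp; exact le_rfl
  -- the two-sided bound
  have both : ∀ h : ℝ → ℝ, ContinuousOn h (Icc t₀ t₁) → (∀ t ∈ Icc t₀ t₁, 0 < h t) →
      (∀ t ∈ Icc t₀ t₁, finf t ≤ h t) → (∫ t in t₀..t₁, |h t - finf t|) ≤ m ^ 2 * η →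
      ∀ p q : ℝ × S, p.1 ∈ Icc t₀ t₁ → q.1 ∈ Icc t₀ t₁ →
      max |τ p - τ q| (dist p.2 q.2) ≤ nullDist (tWarp h) τ t₀ t₁ p q ∧
      nullDist (tWarp h) τ t₀ t₁ p q ≤ max |τ p - τ q| (dist p.2 q.2) + ε := by
    intro h hc hp hge hsmall p q hp1 hq1
    have hclose0 : ∀ u ∈ Icc t₀ t₁, ∀ w ∈ Icc t₀ t₁, u ≤ w →
        (∫ r in u..w, 1 / finf r) - η ≤ ∫ r in u..w, 1 / h r := by
      intro u hu w hw huw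
      have hsub : Icc u w ⊆ Icc t₀ t₁ := Icc_subset_Icc hu.1 hw.2
      have hac : ContinuousOn (fun t => |h t - finf t|) (Icc t₀ t₁) := (hc.sub hfinfc).abs
      have hai : IntervalIntegrable (fun t => |h t - finf t|) MeasureTheory.volume u w := by
        apply ContinuousOn.intervalIntegrable
        rw [uIcc_of_le huw]
        exact hac.mono hsub
      have hai2 : IntervalIntegrable (fun t => |h t - finf t|) MeasureTheory.volume t₀ t₁ := by
        apply ContinuousOn.intervalIntegrable
        rw [uIcc_of_le hle]
        exact hac
      have h1 : (∫ r in u..w, 1 / finf r) - (∫ r in u..w, 1 / h r) ≤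
          ∫ r in u..w, (m ^ 2)⁻¹ * |h r - finf r| := by
        rw [← intervalIntegral.integral_sub (ndp_int hfinfc hfinfpos hu hw) (ndp_int hc hp hu hw)]
        apply intervalIntegral.integral_mono_on huw
          ((ndp_int hfinfc hfinfpos hu hw).sub (ndp_int hc hp hu hw)) (hai.const_mul _)
        intro r hr
        have hr' := hsub hr
        have a1 := hfinfpos r hr'
        have a2 := hp r hr'
        have a3 := hge r hr'
        have a4 := hm r hr'
        rw [abs_of_nonneg (by linarith), div_sub_div _ _ a1.ne' a2.ne', div_eq_inv_mul,
          one_mul, mul_one]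
        apply mul_le_mul_of_nonneg_right _ (by linarith)
        apply inv_anti₀ (by positivity)
        rw [pow_two]
        apply mul_le_mul a4 (a4.trans a3) hm0.le a1.le
      have h2 : ∫ r in u..w, |h r - finf r| ≤ ∫ r in t₀..t₁, |h r - finf r| := by
        apply intervalIntegral.integral_mono_interval hu.1 huw hw.2 _ hai2
        exact Filter.Eventually.of_forall fun r => abs_nonneg _
      rw [intervalIntegral.integral_const_mul] at h1
      have h3 : (m ^ 2)⁻¹ * ∫ r in u..w, |h r - finf r| ≤ η := by
        rw [inv_mul_le_iff₀ (by positivity)]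
        exact h2.trans hsmall
      linarith
    have hsubi : ∀ k : ℝ → ℝ, ContinuousOn k (Icc t₀ t₁) → (∀ t ∈ Icc t₀ t₁, 0 < k t) →
        ∀ u ∈ Icc t₀ t₁, ∀ w ∈ Icc t₀ t₁, u ≤ w →
        |(∫ r in t₀..w, 1 / k r) - ∫ r in t₀..u, 1 / k r| = ∫ r in u..w, 1 / k r := by
      intro k kc kp u hu w hw huw
      rw [intervalIntegral.integral_interval_sub_left (ndp_int kc kp ht₀ hw)
        (ndp_int kc kp ht₀ hu)]
      apply abs_of_nonneg
      exact intervalIntegral.integral_nonneg huw fun r hr =>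
        (one_div_pos.2 (kp r ⟨hu.1.trans hr.1, hr.2.trans hw.2⟩)).le
    have hclose : ∀ u ∈ Icc t₀ t₁, ∀ w ∈ Icc t₀ t₁,
        |(∫ r in t₀..w, 1 / finf r) - ∫ r in t₀..u, 1 / finf r| - η ≤
        |(∫ r in t₀..w, 1 / h r) - ∫ r in t₀..u, 1 / h r| := by
      intro u hu w hw
      rcases le_total u w with huw | huw
      · rw [hsubi _ hfinfc hfinfpos u hu w hw huw, hsubi _ hc hp u hu w hw huw]
        exact hclose0 u hu w hw huw
      · rw [abs_sub_comm, abs_sub_comm (∫ r in t₀..w, 1 / h r),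
          hsubi _ hfinfc hfinfpos w hw u hu huw, hsubi _ hc hp w hw u hu huw]
        exact hclose0 w hw u hu huw
    obtain ⟨γ, hγ⟩ := ndp_upper hLS hc hp hfinfc hfinfpos τ hτ ε η T B hε n hT hTpos hB hB0 hn hη
      hclose p q hp1 hq1
    have hlow := ndp_lower hc hp hfinfc hfinfpos hge τ hτ p q
    constructor
    · refine le_csInf (Set.nonempty_of_mem (x := nullLength τ γ) ⟨γ, rfl⟩) ?_
      rintro L ⟨γ', rfl⟩
      exact hlow γ'
    · refine le_trans (csInf_le ⟨max |τ p - τ q| (dist p.2 q.2), ?_⟩ ⟨γ, rfl⟩) hγ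
      rintro L ⟨γ', rfl⟩
      exact hlow γ'
  have hev := hL1.eventually (gt_mem_nhds (show (0:ℝ) < m ^ 2 * η by positivity))
  obtain ⟨N, hN⟩ := eventually_atTop.1 hev
  refine ⟨N, fun j hj p q hp1 hq1 => ?_⟩
  have b1 := both (f j) (hfc j) (hfpos j) (hlower j) (hN j hj).le p q hp1 hq1
  have b2 := both finf hfinfc hfinfpos (fun _ _ => le_rfl) (by simp; positivity) p q hp1 hq1
  rw [abs_le]
  constructor <;> linarith [b1.1, b1.2, b2.1, b2.2]
end

section
/- Let (Σ,σ) be a compact, connected, continuous Riemannian manifold, M = [t₀,t₁] × Σ, and for each j ∈ ℕ ∪ {∞} let f_j : [t₀,t₁] → (0,∞) be continuous and g_j = −dt² + f_j(t)²σ. If ∫_{t₀}^{t₁} |f_j − f_∞| dt → 0 as j → ∞ and f_j(t) ≥ (1 − 1/j) f_∞(t) for all t ∈ [t₀,t₁] and all j, then the null distances d̂_{t,g_j} with respect to the time function τ(t,x) = t converge uniformly to d̂_{t,g_∞} on M × M. -/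
open Set MeasureTheory Filter Topology

namespace NullDistPaper

/-- time zigzags: start, end, length, reach -/
inductive ZZ (t₀ t₁ : ℝ) (H : ℝ → ℝ) (s : ℝ) : ℝ → ℝ → ℝ → Prop
  | nil (hs : s ∈ Set.Icc t₀ t₁) : ZZ t₀ t₁ H s s 0 0
  | snoc {u L I : ℝ} (v : ℝ) (h : ZZ t₀ t₁ H s u L I) (hv : v ∈ Set.Icc t₀ t₁) :
      ZZ t₀ t₁ H s v (L + |v - u|) (I + |H v - H u|)

theorem ZZ.mem_left {t₀ t₁ : ℝ} {H : ℝ → ℝ} {s t L I : ℝ} (h : ZZ t₀ t₁ H s t L I) :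
    s ∈ Set.Icc t₀ t₁ := by
  induction h with
  | nil hs => exact hs
  | snoc v h hv ih => exact ih

theorem ZZ.mem_right {t₀ t₁ : ℝ} {H : ℝ → ℝ} {s t L I : ℝ} (h : ZZ t₀ t₁ H s t L I) :
    t ∈ Set.Icc t₀ t₁ := by
  induction h with
  | nil hs => exact hs
  | snoc v h hv ih => exact hv

theorem ZZ.trips {t₀ t₁ : ℝ} {H : ℝ → ℝ} {s u L I : ℝ} (h : ZZ t₀ t₁ H s u L I) {c : ℝ}
    (hc : c ∈ Set.Icc t₀ t₁) (r : ℕ) :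
    ZZ t₀ t₁ H s u (L + r * (2 * |c - u|)) (I + r * (2 * |H c - H u|)) := by
  induction r with
  | zero => simpa using h
  | succ r ih =>
    have h2 := (ih.snoc c hc).snoc u h.mem_right
    rw [abs_sub_comm u c, abs_sub_comm (H u) (H c)] at h2
    convert h2 using 1 <;> push_cast <;> ring

/-- structure of zigzags -/
theorem ZZ.hull {t₀ t₁ : ℝ} {H : ℝ → ℝ} (hH : MonotoneOn H (Set.Icc t₀ t₁))
    {s t L I : ℝ} (h : ZZ t₀ t₁ H s t L I) :
    ∃ a b, t₀ ≤ a ∧ b ≤ t₁ ∧ s ∈ Set.Icc a b ∧ t ∈ Set.Icc a b ∧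
      ∀ m ∈ Set.Icc a b, |m - s| + |t - m| ≤ L ∧
        ∀ M, (∀ u ∈ Set.Icc a b, ∀ v ∈ Set.Icc a b, u ≤ v → H v - H u ≤ M * (v - u)) →
        (M * |m - s| - |H m - H s|) + (M * |t - m| - |H t - H m|) ≤ M * L - I := by
  induction h with
  | nil hs =>
    refine ⟨s, s, hs.1, hs.2, by simp, by simp, ?_⟩
    intro m hm
    have : m = s := le_antisymm hm.2 hm.1
    subst this
    simp
  | @snoc u L I v h hv ih =>
    obtain ⟨a, b, ha, hb, hs, hu, key⟩ := ih
    have hab : a ≤ b := hs.1.trans hs.2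
    refine ⟨min a v, max b v, le_min ha hv.1, max_le hb hv.2,
      ⟨(min_le_left _ _).trans hs.1, hs.2.trans (le_max_left _ _)⟩,
      ⟨min_le_right _ _, le_max_right _ _⟩, ?_⟩
    intro m hm
    have hsub : Set.Icc a b ⊆ Set.Icc (min a v) (max b v) :=
      Set.Icc_subset_Icc (min_le_left _ _) (le_max_left _ _)
    have hv' : v ∈ Set.Icc (min a v) (max b v) := ⟨min_le_right _ _, le_max_right _ _⟩
    have tri : ∀ M, (∀ x ∈ Set.Icc (min a v) (max b v), ∀ y ∈ Set.Icc (min a v) (max b v), x ≤ y →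
        H y - H x ≤ M * (y - x)) → ∀ x ∈ Set.Icc (min a v) (max b v),
        ∀ y ∈ Set.Icc (min a v) (max b v), M * |y - x| - |H y - H x|
          = |(M * y - H y) - (M * x - H x)| := by
      intro M hM x hx y hy
      have big : Set.Icc (min a v) (max b v) ⊆ Set.Icc t₀ t₁ :=
        Set.Icc_subset_Icc (le_min ha hv.1) (max_le hb hv.2)
      rcases le_total x y with hxy | hxy
      · have h1 := hM x hx y hy hxy
        have h2 := hH (big hx) (big hy) hxy
        rw [abs_of_nonneg (by linarith), abs_of_nonneg (by linarith), abs_of_nonneg (by linarith)]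
        ring
      · have h1 := hM y hy x hx hxy
        have h2 := hH (big hy) (big hx) hxy
        rw [abs_of_nonpos (by linarith), abs_of_nonpos (by linarith), abs_of_nonpos (by linarith)]
        ring
    by_cases hmab : m ∈ Set.Icc a b
    · obtain ⟨k1, k2⟩ := key m hmab
      refine ⟨by linarith [abs_sub_le v u m], ?_⟩
      intro M hM
      have k3 := k2 M (fun x hx y hy hxy => hM x (hsub hx) y (hsub hy) hxy)
      have e1 := tri M hM m hm v hv'
      have e2 := tri M hM m hm u (hsub hu)
      have e3 := tri M hM u (hsub hu) v hv'
      have := abs_sub_le (M * v - H v) (M * u - H u) (M * m - H m)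
      linarith
    · obtain ⟨k1, k2⟩ := key s hs
      -- m lies between u and v
      have hbet : (u ≤ m ∧ m ≤ v) ∨ (v ≤ m ∧ m ≤ u) := by
        have h1 := hm.1
        have h2 := hm.2
        have h3 := hu.1
        have h4 := hu.2
        simp only [Set.mem_Icc, not_and_or, not_le] at hmab
        rcases hmab with hlt | hlt
        · right
          refine ⟨?_, by linarith⟩
          rcases min_le_iff.mp h1 with h | h
          · linarith
          · exact h
        · left
          refine ⟨by linarith, ?_⟩
          rcases le_max_iff.mp h2 with h | h
          · linarith
          · exact h
      refine ⟨?_, ?_⟩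
      · have : |v - u| = |v - m| + |m - u| := by
          rcases hbet with ⟨h1, h2⟩ | ⟨h1, h2⟩
          · rw [abs_of_nonneg (by linarith), abs_of_nonneg (by linarith), abs_of_nonneg (by linarith)]
            ring
          · rw [abs_of_nonpos (by linarith), abs_of_nonpos (by linarith), abs_of_nonpos (by linarith)]
            ring
        have h3 := abs_sub_le m u s
        simp only [sub_self, abs_zero] at k1
        linarith
      · intro M hM
        have k3 := k2 M (fun x hx y hy hxy => hM x (hsub hx) y (hsub hy) hxy)
        simp only [sub_self, abs_zero, mul_zero, zero_add] at k3
        have e1 := tri M hM s (hsub hs) m hm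
        have e2 := tri M hM s (hsub hs) u (hsub hu)
        have e3 := tri M hM u (hsub hu) m hm
        have e4 := tri M hM u (hsub hu) v hv'
        have e5 := tri M hM m hm v hv'
        have h3 := abs_sub_le (M * m - H m) (M * u - H u) (M * s - H s)
        have : |(M * v - H v) - (M * u - H u)| =
            |(M * v - H v) - (M * m - H m)| + |(M * m - H m) - (M * u - H u)| := by
          rcases hbet with ⟨h1, h2⟩ | ⟨h1, h2⟩
          · have g1 := hM u (hsub hu) m hm h1
            have g2 := hM m hm v hv' h2
            rw [abs_of_nonneg (by linarith), abs_of_nonneg (by linarith), abs_of_nonneg (by linarith)]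
            ring
          · have g1 := hM v hv' m hm h1
            have g2 := hM m hm u (hsub hu) h2
            rw [abs_of_nonpos (by linarith), abs_of_nonpos (by linarith), abs_of_nonpos (by linarith)]
            ring
        linarith

/-- unit speed curves -/
theorem exists_lipschitz {S : Type*} [MetricSpace S] (hLS : IsLengthSpace S) (x y : S) (L : ℝ)
    (hL : dist x y < L) :
    ∃ γ : ℝ → S, LipschitzWith 1 γ ∧ γ 0 = x ∧ γ L = y := by
  obtain ⟨g, g0, g1, gc, gv⟩ := hLS x y (L - dist x y) (by linarith)
  have hL0 : 0 ≤ L := dist_nonneg.trans hL.le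
  rw [add_sub_cancel] at gv
  have hbv : BoundedVariationOn g (Set.Icc 0 1) := ne_top_of_le_ne_top ENNReal.ofReal_ne_top gv
  have hf := hbv.locallyBoundedVariationOn
  have h0 : (0:ℝ) ∈ Set.Icc (0:ℝ) 1 := by simp
  have h1 : (1:ℝ) ∈ Set.Icc (0:ℝ) 1 := by simp
  set v := variationOnFromTo g (Set.Icc 0 1) 0 with hv
  have v0 : v 0 = 0 := variationOnFromTo.self _ _ _
  have v1 : v 1 ≤ L := by
    rw [hv, variationOnFromTo.eq_of_le _ _ zero_le_one, Set.inter_self]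
    exact ENNReal.toReal_le_of_le_ofReal hL0 gv
  have vmono : MonotoneOn v (Set.Icc 0 1) := variationOnFromTo.monotoneOn hf h0
  have vnn : 0 ≤ v 1 := by rw [← v0]; exact vmono h0 h1 zero_le_one
  have vc : ContinuousOn v (Set.Icc 0 1) := by
    intro b hb
    have hl : ContinuousWithinAt v (Set.Icc 0 1 ∩ Set.Iio b) b := by
      have := variationOnFromTo.tendsto_left h0 hb hf ((gc b hb).mono_left
        (nhdsWithin_mono _ Set.inter_subset_left))
      rw [dist_self, sub_zero] at this
      exact this
    have hr : ContinuousWithinAt v (Set.Icc 0 1 ∩ Set.Ioi b) b := by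
      have := variationOnFromTo.tendsto_right h0 hb hf ((gc b hb).mono_left
        (nhdsWithin_mono _ Set.inter_subset_left))
      rw [dist_self, add_zero] at this
      exact this
    have := ((hl.union hr).insert)
    refine this.mono ?_
    intro z hz
    rcases lt_trichotomy z b with h | h | h
    · exact Or.inr (Or.inl ⟨hz, h⟩)
    · exact Or.inl h
    · exact Or.inr (Or.inr ⟨hz, h⟩)
  have hd : ∀ a ∈ Set.Icc (0:ℝ) 1, ∀ b ∈ Set.Icc (0:ℝ) 1, a ≤ b → dist (g a) (g b) ≤ v b - v a := by
    intro a ha b hb hab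
    rw [hv, variationOnFromTo.sub_right hf h0 hb ha, variationOnFromTo.eq_of_le _ _ hab, dist_edist]
    exact ENNReal.toReal_mono (hf a b ha hb)
      (eVariationOn.edist_le g ⟨ha, le_rfl, hab⟩ ⟨hb, hab, le_rfl⟩)
  have hd2 : ∀ a ∈ Set.Icc (0:ℝ) 1, ∀ b ∈ Set.Icc (0:ℝ) 1, dist (g a) (g b) ≤ |v a - v b| := by
    intro a ha b hb
    rcases le_total a b with h | h
    · rw [abs_sub_comm]; exact (hd a ha b hb h).trans (le_abs_self _)
    · rw [dist_comm]; exact (hd b hb a ha h).trans (le_abs_self _)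
  have hsurj : ∀ z : ℝ, ∃ τ ∈ Set.Icc (0:ℝ) 1, v τ = max 0 (min z (v 1)) := by
    intro z
    have := intermediate_value_Icc zero_le_one vc
    rw [v0] at this
    exact this ⟨le_max_left _ _, max_le vnn (min_le_right _ _)⟩
  choose τ hτ hvτ using hsurj
  refine ⟨fun z => g (τ z), ?_, ?_, ?_⟩
  · refine LipschitzWith.of_dist_le_mul fun z w => ?_
    refine (hd2 _ (hτ z) _ (hτ w)).trans ?_
    rw [hvτ, hvτ, NNReal.coe_one, one_mul, Real.dist_eq]
    calc _ ≤ |min z (v 1) - min w (v 1)| := by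
            have := abs_max_sub_max_le_abs (min z (v 1)) (min w (v 1)) 0
            simpa [max_comm] using this
      _ ≤ _ := by
            have := abs_min_sub_min_le_max z (v 1) w (v 1)
            simpa using this
  · have := hd2 _ (hτ 0) 0 h0
    rw [hvτ, v0, min_eq_left vnn] at this
    simp only [max_self, sub_self, abs_zero] at this
    rw [← g0]
    exact dist_le_zero.mp this
  · have := hd2 _ (hτ L) 1 h1
    rw [hvτ, min_eq_right v1, max_eq_right vnn, sub_self, abs_zero] at this
    rw [← g1]
    exact dist_le_zero.mp this

end NullDistPaper
namespace NullDistPaper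

/-- append a causal piece -/
theorem PiecewiseCausal.exists_snoc {S : Type*} [PseudoMetricSpace S] {f : ℝ → S → ℝ} {t₀ t₁ : ℝ}
    {p q r : ℝ × S}
    (P : PiecewiseCausal f t₀ t₁ p q) (hr : r.1 ∈ Set.Icc t₀ t₁) (h : CausallyRelated f q r) :
    ∃ P' : PiecewiseCausal f t₀ t₁ p r,
      nullLength (fun p => p.1) P' = nullLength (fun p => p.1) P + |r.1 - q.1| := by
  refine ⟨⟨P.k + 1, Nat.succ_pos _, fun i => if i ≤ P.k then P.pt i else r, ?_, ?_, ?_, ?_⟩, ?_⟩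
  · simp [P.h0]
  · simp
  · intro i hi
    by_cases h' : i ≤ P.k
    · simp only [h', if_true]; exact P.hstrip i h'
    · simp only [h', if_false]; exact hr
  · intro i hi
    by_cases h' : i < P.k
    · have h1 : i ≤ P.k := h'.le
      have h2 : i + 1 ≤ P.k := h'
      simp only [h1, h2, if_true]; exact P.piece i h'
    · have h1 : i = P.k := by omega
      subst h1
      simp [P.hlast, h]
  · simp only [nullLength]
    rw [Finset.sum_range_succ]
    congr 1
    · refine Finset.sum_congr rfl fun i hi => ?_
      have h' := Finset.mem_range.mp hi
      have h1 : i ≤ P.k := h'.le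
      have h2 : i + 1 ≤ P.k := h'
      simp [h1, h2]
    · simp [P.hlast]

theorem causal_of_lipschitz {S : Type*} [PseudoMetricSpace S] {t₀ t₁ : ℝ} {f H : ℝ → ℝ}
    (hHm : MonotoneOn H (Set.Icc t₀ t₁)) (hHc : ContinuousOn H (Set.Icc t₀ t₁))
    (hHi : ∀ u ∈ Set.Icc t₀ t₁, ∀ v ∈ Set.Icc t₀ t₁, ∫ t in u..v, 1 / f t = H v - H u)
    {γ : ℝ → S} (hγ : LipschitzWith 1 γ) {u v : ℝ} (hu : u ∈ Set.Icc t₀ t₁)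
    (hv : v ∈ Set.Icc t₀ t₁) (c : ℝ) :
    CausallyRelated (tWarp f) (u, γ c) (v, γ (c + |H v - H u|)) := by
  rcases le_total u v with huv | huv
  · left
    have hsub : Set.Icc u v ⊆ Set.Icc t₀ t₁ := Set.Icc_subset_Icc hu.1 hv.2
    have h1 := hHm hu hv huv
    refine ⟨huv, γ ∘ (fun τ => c + (H τ - H u)), by simp, ?_, huv, ?_, ?_⟩
    · simp [abs_of_nonneg (sub_nonneg.mpr h1)]
    · refine hγ.continuous.comp_continuousOn ?_
      exact continuousOn_const.add ((hHc.mono hsub).sub continuousOn_const)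
    · intro a ha b hb hab
      refine (hγ.lipschitzOnWith.comp_eVariationOn_le (Set.mapsTo_univ _ _)).trans ?_
      simp only [tWarp]
      rw [hHi a (hsub ha) b (hsub hb), ENNReal.coe_one, one_mul]
      have hm : MonotoneOn (fun τ => c + (H τ - H u)) (Set.Icc a b) := by
        intro y hy z hz hyz
        have := hHm (hsub ⟨ha.1.trans hy.1, hy.2.trans hb.2⟩)
          (hsub ⟨ha.1.trans hz.1, hz.2.trans hb.2⟩) hyz
        simp only; linarith
      have := hm.eVariationOn_eq (Set.left_mem_Icc.mpr hab) (Set.right_mem_Icc.mpr hab)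
      rw [Set.inter_self] at this
      rw [this]
      apply le_of_eq; congr 1; ring
  · right
    have hsub : Set.Icc v u ⊆ Set.Icc t₀ t₁ := Set.Icc_subset_Icc hv.1 hu.2
    have h1 := hHm hv hu huv
    have hg : LipschitzWith 1 (fun z => γ (-z)) := by
      refine LipschitzWith.of_dist_le_mul fun z w => ?_
      have := hγ.dist_le_mul (-z) (-w)
      rwa [dist_neg_neg] at this
    refine ⟨huv, (fun z => γ (-z)) ∘ (fun τ => -c + (H τ - H u)), ?_, by simp, huv, ?_, ?_⟩
    · simp only [Function.comp]
      congr 1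
      rw [abs_of_nonpos (by linarith)]; ring
    · refine hg.continuous.comp_continuousOn ?_
      exact continuousOn_const.add ((hHc.mono hsub).sub continuousOn_const)
    · intro a ha b hb hab
      refine (hg.lipschitzOnWith.comp_eVariationOn_le (Set.mapsTo_univ _ _)).trans ?_
      simp only [tWarp]
      rw [hHi a (hsub ha) b (hsub hb), ENNReal.coe_one, one_mul]
      have hm : MonotoneOn (fun τ => -c + (H τ - H u)) (Set.Icc a b) := by
        intro y hy z hz hyz
        have := hHm (hsub ⟨ha.1.trans hy.1, hy.2.trans hb.2⟩)
          (hsub ⟨ha.1.trans hz.1, hz.2.trans hb.2⟩) hyz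
        simp only; linarith
      have := hm.eVariationOn_eq (Set.left_mem_Icc.mpr hab) (Set.right_mem_Icc.mpr hab)
      rw [Set.inter_self] at this
      rw [this]
      apply le_of_eq; congr 1; ring

theorem ZZ.realize {S : Type*} [PseudoMetricSpace S] {t₀ t₁ : ℝ} {f H : ℝ → ℝ}
    (hHm : MonotoneOn H (Set.Icc t₀ t₁)) (hHc : ContinuousOn H (Set.Icc t₀ t₁))
    (hHi : ∀ u ∈ Set.Icc t₀ t₁, ∀ v ∈ Set.Icc t₀ t₁, ∫ t in u..v, 1 / f t = H v - H u)
    {γ : ℝ → S} (hγ : LipschitzWith 1 γ) {s t L I : ℝ} (h : ZZ t₀ t₁ H s t L I) :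
    ∃ P : PiecewiseCausal (tWarp f) t₀ t₁ (s, γ 0) (t, γ I),
      nullLength (fun p => p.1) P = L := by
  induction h with
  | nil hs =>
    refine ⟨⟨1, one_pos, fun _ => (s, γ 0), rfl, rfl, fun _ _ => hs, fun i hi => ?_⟩, ?_⟩
    · have := causal_of_lipschitz hHm hHc hHi hγ hs hs 0
      simpa using this
    · simp [nullLength]
  | snoc v h hv ih =>
    obtain ⟨P, hP⟩ := ih
    obtain ⟨P', hP'⟩ := P.exists_snoc hv (causal_of_lipschitz hHm hHc hHi hγ h.mem_right hv _)
    exact ⟨P', by rw [hP', hP]⟩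

theorem nullDist_le_of_ZZ {S : Type*} [MetricSpace S] (hLS : IsLengthSpace S)
    {t₀ t₁ : ℝ} {f H : ℝ → ℝ}
    (hHm : MonotoneOn H (Set.Icc t₀ t₁)) (hHc : ContinuousOn H (Set.Icc t₀ t₁))
    (hHi : ∀ u ∈ Set.Icc t₀ t₁, ∀ v ∈ Set.Icc t₀ t₁, ∫ t in u..v, 1 / f t = H v - H u)
    {p q : ℝ × S} {L I : ℝ} (h : ZZ t₀ t₁ H p.1 q.1 L I) (hI : dist p.2 q.2 < I) :
    (∃ P : PiecewiseCausal (tWarp f) t₀ t₁ p q, nullLength (fun p => p.1) P = L) ∧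
    nullDist (tWarp f) (fun p => p.1) t₀ t₁ p q ≤ L := by
  obtain ⟨γ, hγ, g0, g1⟩ := exists_lipschitz hLS p.2 q.2 I hI
  obtain ⟨P, hP⟩ := h.realize hHm hHc hHi hγ
  rw [g0, g1] at P
  have : ∃ P : PiecewiseCausal (tWarp f) t₀ t₁ p q, nullLength (fun p => p.1) P = L := by
    have h2 := h.realize hHm hHc hHi hγ
    rw [g0, g1] at h2
    exact h2
  refine ⟨this, ?_⟩
  obtain ⟨P, hP⟩ := this
  refine csInf_le ⟨0, ?_⟩ ⟨P, hP.symm⟩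
  rintro _ ⟨Q, rfl⟩
  exact Finset.sum_nonneg fun _ _ => abs_nonneg _

theorem FutureRelated.dist_le {S : Type*} [PseudoMetricSpace S] {t₀ t₁ : ℝ} {f H : ℝ → ℝ}
    (hHm : MonotoneOn H (Set.Icc t₀ t₁))
    (hHi : ∀ u ∈ Set.Icc t₀ t₁, ∀ v ∈ Set.Icc t₀ t₁, ∫ t in u..v, 1 / f t = H v - H u)
    {p q : ℝ × S} (hp : p.1 ∈ Set.Icc t₀ t₁) (hq : q.1 ∈ Set.Icc t₀ t₁)
    (h : FutureRelated (tWarp f) p q) : dist p.2 q.2 ≤ |H q.1 - H p.1| := by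
  obtain ⟨hle, x, x0, x1, -, -, hx⟩ := h
  have h1 := hx p.1 (Set.left_mem_Icc.mpr hle) q.1 (Set.right_mem_Icc.mpr hle) hle
  simp only [tWarp] at h1
  rw [hHi _ hp _ hq] at h1
  have h2 := (eVariationOn.edist_le x (Set.left_mem_Icc.mpr hle) (Set.right_mem_Icc.mpr hle)).trans h1
  rw [x0, x1, edist_dist, ENNReal.ofReal_le_ofReal_iff (by linarith [hHm hp hq hle])] at h2
  exact h2.trans (le_abs_self _)

theorem PiecewiseCausal.toZZ {S : Type*} [PseudoMetricSpace S] {t₀ t₁ : ℝ} {f H : ℝ → ℝ}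
    (hHm : MonotoneOn H (Set.Icc t₀ t₁))
    (hHi : ∀ u ∈ Set.Icc t₀ t₁, ∀ v ∈ Set.Icc t₀ t₁, ∫ t in u..v, 1 / f t = H v - H u)
    {p q : ℝ × S} (P : PiecewiseCausal (tWarp f) t₀ t₁ p q) :
    ∃ I, ZZ t₀ t₁ H p.1 q.1 (nullLength (fun p => p.1) P) I ∧ dist p.2 q.2 ≤ I := by
  have key : ∀ n ≤ P.k, ∃ I, ZZ t₀ t₁ H p.1 (P.pt n).1
      (∑ i ∈ Finset.range n, |(P.pt (i + 1)).1 - (P.pt i).1|) I ∧ dist p.2 (P.pt n).2 ≤ I := by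
    intro n
    induction n with
    | zero =>
      intro _
      refine ⟨0, ?_, ?_⟩
      · rw [P.h0]
        have := P.hstrip 0 (Nat.zero_le _)
        rw [P.h0] at this
        simpa using ZZ.nil (H := H) this
      · simp [P.h0]
    | succ n ih =>
      intro hn
      obtain ⟨I, h1, h2⟩ := ih (by omega)
      refine ⟨I + |H (P.pt (n + 1)).1 - H (P.pt n).1|, ?_, ?_⟩
      · rw [Finset.sum_range_succ]
        exact h1.snoc _ (P.hstrip _ hn)
      · refine (dist_triangle _ (P.pt n).2 _).trans (add_le_add h2 ?_)
        have a1 := P.hstrip n (by omega)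
        have a2 := P.hstrip (n+1) hn
        rcases P.piece n (by omega) with h | h
        · exact h.dist_le hHm hHi a1 a2
        · rw [dist_comm, abs_sub_comm]
          exact h.dist_le hHm hHi a2 a1
  have := key P.k le_rfl
  rw [P.hlast] at this
  exact this

theorem ZZ.improve {t₀ t₁ : ℝ} (hlt : t₀ < t₁) {h H : ℝ → ℝ} (hh : ContinuousOn h (Set.Icc t₀ t₁))
    (hpos : ∀ t ∈ Set.Icc t₀ t₁, 0 < h t)
    (hHi : ∀ u ∈ Set.Icc t₀ t₁, ∀ v ∈ Set.Icc t₀ t₁, ∫ t in u..v, h t = H v - H u)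
    (hHm : MonotoneOn H (Set.Icc t₀ t₁))
    (C ε : ℝ) (hC : 0 < C) (hε : 0 < ε) :
    ∃ η > 0, ∀ K : ℝ → ℝ, 
      (∀ u ∈ Set.Icc t₀ t₁, ∀ v ∈ Set.Icc t₀ t₁, |(K v - K u) - (H v - H u)| ≤ η) →
      ∀ s t L I, ZZ t₀ t₁ H s t L I → L ≤ C →
        ∃ L' I', ZZ t₀ t₁ K s t L' I' ∧ L' ≤ L + ε ∧ I + η ≤ I' := by
  obtain ⟨xm, hxm, hmin⟩ := isCompact_Icc.exists_isMinOn (Set.nonempty_Icc.mpr hlt.le) hh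
  set c0 := h xm with hc0
  have c0pos : 0 < c0 := hpos xm hxm
  have hmin' : ∀ t ∈ Set.Icc t₀ t₁, c0 ≤ h t := fun t ht => hmin ht
  obtain ⟨κ, κpos, κ1, κ2⟩ : ∃ κ > 0, κ ≤ c0 / 4 ∧ 4 * κ * C ≤ c0 * (ε / 3) := by
    refine ⟨min (c0 / 4) (c0 * (ε / 3) / (4 * C)), by positivity, min_le_left _ _, ?_⟩
    have := min_le_right (c0 / 4) (c0 * (ε / 3) / (4 * C))
    rw [le_div_iff₀ (by positivity)] at this
    linarith
  have huc := isCompact_Icc.uniformContinuousOn_of_continuous hh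
  rw [Metric.uniformContinuousOn_iff_le] at huc
  obtain ⟨δ, δpos, hδ⟩ := huc κ κpos
  obtain ⟨w, wpos, w1, w2, w3⟩ : ∃ w > 0, w ≤ δ ∧ w ≤ (t₁ - t₀) / 2 ∧ w ≤ ε / 6 := by
    have : 0 < t₁ - t₀ := by linarith
    refine ⟨min δ (min ((t₁ - t₀) / 2) (ε / 6)), by positivity, min_le_left _ _,
      (min_le_right _ _).trans (min_le_left _ _), (min_le_right _ _).trans (min_le_right _ _)⟩
  obtain ⟨η, ηpos, η1, η2⟩ : ∃ η > 0, η ≤ κ * w ∧ η ≤ c0 * ε / 18 :=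
    ⟨min (κ * w) (c0 * ε / 18), by positivity, min_le_left _ _, min_le_right _ _⟩
  refine ⟨η, ηpos, ?_⟩
  intro K hK s t L I hZ hLC
  obtain ⟨a, b, ha, hb, hs, ht, key⟩ := hZ.hull hHm
  have hsub : Set.Icc a b ⊆ Set.Icc t₀ t₁ := Set.Icc_subset_Icc ha hb
  obtain ⟨m, hm, hmax⟩ := isCompact_Icc.exists_isMaxOn ⟨s, hs⟩ (hh.mono hsub)
  have hmax' : ∀ z ∈ Set.Icc a b, h z ≤ h m := fun z hz => hmax hz
  obtain ⟨k1, k2⟩ := key m hm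
  set M := h m with hM
  have hint : ∀ u ∈ Set.Icc t₀ t₁, ∀ v ∈ Set.Icc t₀ t₁, IntervalIntegrable h volume u v := by
    intro u hu v hv
    exact (hh.mono (Set.uIcc_subset_Icc hu hv)).intervalIntegrable
  have k3 := k2 M (by
    intro u hu v hv huv
    rw [← hHi u (hsub hu) v (hsub hv)]
    have := intervalIntegral.integral_mono_on huv (hint u (hsub hu) v (hsub hv))
      (intervalIntegrable_const (c := M)) (fun z hz => hmax' z ⟨hu.1.trans hz.1, hz.2.trans hv.2⟩)
    rw [intervalIntegral.integral_const, smul_eq_mul] at this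
    linarith)
  have hmT := hsub hm
  have hMc : c0 ≤ M := hmin' m hmT
  -- lower bound near m
  have hlow : ∀ u ∈ Set.Icc t₀ t₁, ∀ v ∈ Set.Icc t₀ t₁, u ≤ v → m ∈ Set.Icc u v → v - u ≤ w →
      (M - κ) * (v - u) ≤ H v - H u := by
    intro u hu v hv huv hmuv hw
    rw [← hHi u hu v hv]
    have := intervalIntegral.integral_mono_on huv 
      (intervalIntegrable_const (c := M - κ)) (hint u hu v hv) (fun z hz => by
        have := hδ z ⟨hu.1.trans hz.1, hz.2.trans hv.2⟩ m hmT (by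
          rw [Real.dist_eq, abs_le]
          constructor <;> linarith [hz.1, hz.2, hmuv.1, hmuv.2])
        rw [Real.dist_eq, abs_le] at this
        linarith [this.1])
    rw [intervalIntegral.integral_const, smul_eq_mul] at this
    linarith
  obtain ⟨c, hc, hcw, hcH⟩ : ∃ c ∈ Set.Icc t₀ t₁, |c - m| = w ∧ (M - κ) * w ≤ |H c - H m| := by
    by_cases hmid : m + w ≤ t₁
    · have hc : m + w ∈ Set.Icc t₀ t₁ := ⟨by linarith [hmT.1], hmid⟩
      refine ⟨m + w, hc, by simp [abs_of_pos wpos], ?_⟩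
      have := hlow m hmT _ hc (by linarith) ⟨le_rfl, by linarith⟩ (by linarith)
      rw [add_sub_cancel_left] at this
      exact this.trans (le_abs_self _)
    · have hc : m - w ∈ Set.Icc t₀ t₁ := ⟨by linarith [hmT.1], by linarith [hmT.2]⟩
      refine ⟨m - w, hc, by simp [abs_of_pos wpos], ?_⟩
      have := hlow _ hc m hmT (by linarith) ⟨by linarith, le_rfl⟩ (by linarith)
      rw [sub_sub_cancel] at this
      rw [abs_sub_comm]
      exact this.trans (le_abs_self _)
  have Kabs : ∀ u ∈ Set.Icc t₀ t₁, ∀ v ∈ Set.Icc t₀ t₁, |H v - H u| - η ≤ |K v - K u| := by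
    intro u hu v hv
    have h1 := hK u hu v hv
    have h2 := abs_sub_abs_le_abs_sub (H v - H u) (K v - K u)
    rw [abs_sub_comm (H v - H u)] at h2
    linarith
  have hcK : (M - 2 * κ) * w ≤ |K c - K m| := by
    have := Kabs m hmT c hc
    linarith
  have hA : 0 < M - 2 * κ := by linarith
  set L0 := |m - s| + |t - m| with hL0
  set R := M * (L - L0) + 3 * η with hR
  have hRpos : 0 < R := by
    have : 0 ≤ M * (L - L0) := mul_nonneg (by linarith) (by linarith)
    linarith
  set r := ⌈R / (2 * ((M - 2 * κ) * w))⌉₊ with hr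
  have hden : 0 < 2 * ((M - 2 * κ) * w) := by positivity
  have r1 : R ≤ r * (2 * ((M - 2 * κ) * w)) := by
    rw [← div_le_iff₀ hden]; exact Nat.le_ceil _
  have r2 : (r:ℝ) * (2 * ((M - 2 * κ) * w)) < R + 2 * ((M - 2 * κ) * w) := by
    have : (r:ℝ) < R / (2 * ((M - 2 * κ) * w)) + 1 := Nat.ceil_lt_add_one (by positivity)
    have h2 := mul_lt_mul_of_pos_right this hden
    rwa [add_mul, div_mul_cancel₀ _ hden.ne', one_mul] at h2
  have Z := (((ZZ.nil (H := K) (hsub hs)).snoc m hmT).trips hc r).snoc t (hsub ht)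
  refine ⟨_, _, Z, ?_, ?_⟩
  · rw [hcw]
    -- extra length
    suffices hX : (r:ℝ) * (2 * w) ≤ (L - L0) + ε by
      rw [hL0] at hX; linarith
    have hX : (M - 2 * κ) * ((r:ℝ) * (2 * w)) ≤ (M - 2 * κ) * ((L - L0) + ε) := by
      have e1 : (M - 2 * κ) * ((r:ℝ) * (2 * w)) = (r:ℝ) * (2 * ((M - 2 * κ) * w)) := by ring
      rw [e1]
      refine r2.le.trans ?_
      have hLL : L - L0 ≤ C := by
        have : 0 ≤ L0 := by positivity
        linarith
      have q1 : κ * (L - L0) ≤ κ * C := mul_le_mul_of_nonneg_left hLL κpos.le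
      have q2 : (M - 2 * κ) * w ≤ (M - 2 * κ) * (ε / 6) := mul_le_mul_of_nonneg_left w3 hA.le
      have q3 : c0 / 2 * ε ≤ (M - 2 * κ) * ε := mul_le_mul_of_nonneg_right (by linarith) hε.le
      rw [hR]
      nlinarith
    exact le_of_mul_le_mul_left hX hA
  · have e1 := Kabs s (hsub hs) m hmT
    have e2 := Kabs m hmT t (hsub ht)
    have e3 : (r:ℝ) * (2 * ((M - 2 * κ) * w)) ≤ r * (2 * |K c - K m|) := by
      have : (0:ℝ) ≤ r := Nat.cast_nonneg _
      gcongr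
    have e4 : R = M * L - M * |m - s| - M * |t - m| + 3 * η := by rw [hR, hL0]; ring
    linarith

end NullDistPaper
namespace NullDistPaper

theorem ZZ.change {t₀ t₁ : ℝ} {H K : ℝ → ℝ} {c : ℝ}
    (hHK : ∀ u ∈ Set.Icc t₀ t₁, ∀ v ∈ Set.Icc t₀ t₁, c * |K v - K u| ≤ |H v - H u|)
    {s t L I : ℝ} (h : ZZ t₀ t₁ K s t L I) : ∃ I', ZZ t₀ t₁ H s t L I' ∧ c * I ≤ I' := by
  induction h with
  | nil hs => exact ⟨0, ZZ.nil hs, by simp⟩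
  | snoc v h hv ih =>
    obtain ⟨I', h1, h2⟩ := ih
    refine ⟨_, h1.snoc v hv, ?_⟩
    have := hHK _ h.mem_right _ hv
    linarith

theorem prim_facts {t₀ t₁ : ℝ} {f : ℝ → ℝ} (hle : t₀ ≤ t₁)
    (hfc : ContinuousOn f (Set.Icc t₀ t₁)) (hfpos : ∀ t ∈ Set.Icc t₀ t₁, 0 < f t) :
    ContinuousOn (fun t => 1 / f t) (Set.Icc t₀ t₁) ∧
    (∀ u ∈ Set.Icc t₀ t₁, ∀ v ∈ Set.Icc t₀ t₁,
      IntervalIntegrable (fun t => 1 / f t) volume u v) ∧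
    (∀ u ∈ Set.Icc t₀ t₁, ∀ v ∈ Set.Icc t₀ t₁,
      ∫ t in u..v, 1 / f t = (∫ t in t₀..v, 1 / f t) - ∫ t in t₀..u, 1 / f t) ∧
    MonotoneOn (fun v => ∫ t in t₀..v, 1 / f t) (Set.Icc t₀ t₁) ∧
    ContinuousOn (fun v => ∫ t in t₀..v, 1 / f t) (Set.Icc t₀ t₁) := by
  have h1 : ContinuousOn (fun t => 1 / f t) (Set.Icc t₀ t₁) :=
    continuousOn_const.div hfc fun t ht => (hfpos t ht).ne'
  have h2 : ∀ u ∈ Set.Icc t₀ t₁, ∀ v ∈ Set.Icc t₀ t₁,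
      IntervalIntegrable (fun t => 1 / f t) volume u v := fun u hu v hv =>
    (h1.mono (Set.uIcc_subset_Icc hu hv)).intervalIntegrable
  have h0 : t₀ ∈ Set.Icc t₀ t₁ := Set.left_mem_Icc.mpr hle
  have h3 : ∀ u ∈ Set.Icc t₀ t₁, ∀ v ∈ Set.Icc t₀ t₁,
      ∫ t in u..v, 1 / f t = (∫ t in t₀..v, 1 / f t) - ∫ t in t₀..u, 1 / f t := fun u hu v hv =>
    (intervalIntegral.integral_interval_sub_left (h2 _ h0 _ hv) (h2 _ h0 _ hu)).symm
  refine ⟨h1, h2, h3, ?_, ?_⟩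
  · intro u hu v hv huv
    have := intervalIntegral.integral_nonneg (μ := volume) huv (f := fun t => 1 / f t) (fun t ht =>
      (one_div_pos.mpr (hfpos t ⟨hu.1.trans ht.1, ht.2.trans hv.2⟩)).le)
    rw [h3 u hu v hv] at this
    simp only; linarith
  · have := intervalIntegral.continuousOn_primitive_interval (a := t₀) (b := t₁) (μ := volume)
      (f := fun t => 1 / f t) (by rw [Set.uIcc_of_le hle]; exact h1.integrableOn_Icc)
    rwa [Set.uIcc_of_le hle] at this

theorem nullDist_degenerate {S : Type*} [PseudoMetricSpace S] (t₀ t₁ : ℝ) (heq : t₀ = t₁)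
    (f : ℕ → ℝ → ℝ) (finf : ℝ → ℝ) :
    ∀ ε > 0, ∃ N : ℕ, ∀ j ≥ N, ∀ p q : ℝ × S,
      p.1 ∈ Set.Icc t₀ t₁ → q.1 ∈ Set.Icc t₀ t₁ →
      |nullDist (tWarp (f j)) (fun p => p.1) t₀ t₁ p q -
        nullDist (tWarp finf) (fun p => p.1) t₀ t₁ p q| ≤ ε := by
  intro ε hε
  refine ⟨0, fun j _ p q _ _ => ?_⟩
  have : ∀ g : ℝ → S → ℝ, nullDist g (fun p => p.1) t₀ t₁ p q = 0 := by
    intro g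
    have hz : ∀ P : PiecewiseCausal g t₀ t₁ p q, nullLength (fun p => p.1) P = 0 := by
      intro P
      refine Finset.sum_eq_zero fun i hi => ?_
      have hi' := Finset.mem_range.mp hi
      have a1 := P.hstrip i hi'.le
      have a2 := P.hstrip (i+1) hi'
      subst heq
      rw [Set.Icc_self, Set.mem_singleton_iff] at a1 a2
      simp [a1, a2]
    unfold nullDist
    by_cases hne : Nonempty (PiecewiseCausal g t₀ t₁ p q)
    · obtain ⟨P⟩ := hne
      have : {L : ℝ | ∃ γ : PiecewiseCausal g t₀ t₁ p q, L = nullLength (fun p => p.1) γ} = {0} := by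
        ext L
        constructor
        · rintro ⟨Q, rfl⟩; exact hz Q
        · rintro rfl; exact ⟨P, (hz P).symm⟩
      rw [this, csInf_singleton]
    · have : {L : ℝ | ∃ γ : PiecewiseCausal g t₀ t₁ p q, L = nullLength (fun p => p.1) γ} = ∅ := by
        ext L
        simp only [Set.mem_ofPred_eq, Set.mem_empty_iff_false, iff_false]
        rintro ⟨Q, -⟩; exact hne ⟨Q⟩
      rw [this, Real.sInf_empty]
  rw [this, this]
  simpa using hε.le

theorem exists_near {S : Type*} [PseudoMetricSpace S] {g : ℝ → S → ℝ} {t₀ t₁ : ℝ} {p q : ℝ × S}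
    (hne : Nonempty (PiecewiseCausal g t₀ t₁ p q)) {ε : ℝ} (hε : 0 < ε) :
    ∃ P : PiecewiseCausal g t₀ t₁ p q,
      nullLength (fun p => p.1) P < nullDist g (fun p => p.1) t₀ t₁ p q + ε := by
  obtain ⟨P⟩ := hne
  have : {L : ℝ | ∃ γ : PiecewiseCausal g t₀ t₁ p q, L = nullLength (fun p => p.1) γ}.Nonempty :=
    ⟨_, P, rfl⟩
  obtain ⟨_, ⟨Q, rfl⟩, hQ⟩ := Real.lt_sInf_add_pos this hε
  exact ⟨Q, hQ⟩

theorem nullDist_main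
    {S : Type*} [MetricSpace S] [CompactSpace S]
    (hLS : IsLengthSpace S)
    (t₀ t₁ : ℝ) (hlt : t₀ < t₁)
    (f : ℕ → ℝ → ℝ) (finf : ℝ → ℝ)
    (hfc : ∀ j, ContinuousOn (f j) (Set.Icc t₀ t₁))
    (hfinfc : ContinuousOn finf (Set.Icc t₀ t₁))
    (hfpos : ∀ j, ∀ t ∈ Set.Icc t₀ t₁, 0 < f j t)
    (hfinfpos : ∀ t ∈ Set.Icc t₀ t₁, 0 < finf t)
    (hL1 : Tendsto (fun j => ∫ t in t₀..t₁, |f j t - finf t|) atTop (nhds 0))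
    (hlower : ∀ j : ℕ, 1 ≤ j → ∀ t ∈ Set.Icc t₀ t₁, (1 - 1 / (j : ℝ)) * finf t ≤ f j t) :
    ∀ ε > 0, ∃ N : ℕ, ∀ j ≥ N, ∀ p q : ℝ × S,
      p.1 ∈ Set.Icc t₀ t₁ → q.1 ∈ Set.Icc t₀ t₁ →
      |nullDist (tWarp (f j)) (fun p => p.1) t₀ t₁ p q -
        nullDist (tWarp finf) (fun p => p.1) t₀ t₁ p q| ≤ ε := by
  intro ε₀ hε₀
  obtain ⟨ε, hε, hε1, hεε⟩ : ∃ ε > 0, ε ≤ 1 ∧ ε ≤ ε₀ :=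
    ⟨min 1 ε₀, by positivity, min_le_left _ _, min_le_right _ _⟩
  obtain ⟨hc, hii, hi, hm, hcc⟩ := prim_facts hlt.le hfinfc hfinfpos
  have hF := fun j => prim_facts hlt.le (hfc j) (hfpos j)
  set H : ℝ → ℝ := fun v => ∫ t in t₀..v, 1 / finf t with hH
  set K : ℕ → ℝ → ℝ := fun j v => ∫ t in t₀..v, 1 / f j t with hK
  have h0 : t₀ ∈ Set.Icc t₀ t₁ := Set.left_mem_Icc.mpr hlt.le
  have h1 : t₁ ∈ Set.Icc t₀ t₁ := Set.right_mem_Icc.mpr hlt.le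
  have hpos : ∀ t ∈ Set.Icc t₀ t₁, 0 < 1 / finf t := fun t ht => one_div_pos.mpr (hfinfpos t ht)
  -- diameter
  set D := Metric.diam (Set.univ : Set S) with hD
  have hDd : ∀ x y : S, dist x y ≤ D := fun x y =>
    Metric.dist_le_diam_of_mem isCompact_univ.isBounded (Set.mem_univ x) (Set.mem_univ y)
  have hD0 : 0 ≤ D := Metric.diam_nonneg
  -- uniform bound
  have hHpos : 0 < H t₁ - H t₀ := by
    rw [← hi t₀ h0 t₁ h1]
    exact intervalIntegral.intervalIntegral_pos_of_pos_on (hii _ h0 _ h1)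
      (fun t ht => hpos t ⟨ht.1.le, ht.2.le⟩) hlt
  obtain ⟨r, hr⟩ := exists_nat_gt (D / (H t₁ - H t₀))
  rw [div_lt_iff₀ hHpos] at hr
  set T := t₁ - t₀ with hT
  have hTpos : 0 < T := by rw [hT]; linarith
  set C := (2 * r + 2) * T with hC
  have hCpos : 0 < C := by positivity
  have hbase : ∀ p q : ℝ × S, p.1 ∈ Set.Icc t₀ t₁ → q.1 ∈ Set.Icc t₀ t₁ →
      Nonempty (PiecewiseCausal (tWarp finf) t₀ t₁ p q) ∧
      nullDist (tWarp finf) (fun p => p.1) t₀ t₁ p q ≤ C := by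
    intro p q hp hq
    have Z := (((ZZ.nil (H := H) hp).snoc t₀ h0).trips h1 r).snoc q.1 hq
    obtain ⟨⟨P, -⟩, h3⟩ := nullDist_le_of_ZZ hLS hm hcc hi Z (by
      have a1 := abs_nonneg (H t₀ - H p.1)
      have a2 := abs_nonneg (H q.1 - H t₀)
      have a3 := hDd p.2 q.2
      rw [abs_of_pos hHpos]
      have : 0 ≤ (r:ℝ) * (H t₁ - H t₀) := by positivity
      linarith)
    refine ⟨⟨P⟩, h3.trans ?_⟩
    have b1 : |t₀ - p.1| ≤ T := by rw [abs_le]; constructor <;> linarith [hp.1, hp.2]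
    have b2 : |q.1 - t₀| ≤ T := by rw [abs_le]; constructor <;> linarith [hq.1, hq.2]
    rw [← hT, abs_of_pos hTpos, hC]
    linarith
  obtain ⟨η, ηpos, himp⟩ := ZZ.improve hlt hc hpos hi hm (C + 2) (ε / 2) (by linarith) (by linarith)
  -- convergence of the primitives
  obtain ⟨xm, hxm, hmin⟩ := isCompact_Icc.exists_isMinOn (Set.nonempty_Icc.mpr hlt.le) hfinfc
  set c1 := finf xm with hc1
  have c1pos : 0 < c1 := hfinfpos xm hxm
  have hmin' : ∀ t ∈ Set.Icc t₀ t₁, c1 ≤ finf t := fun t ht => hmin ht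
  have hlim : Tendsto (fun j => 2 / c1 ^ 2 * ∫ t in t₀..t₁, |f j t - finf t|) atTop (nhds 0) := by
    simpa using hL1.const_mul (2 / c1 ^ 2)
  obtain ⟨N1, hN1⟩ := eventually_atTop.mp (hlim.eventually_lt_const ηpos)
  obtain ⟨N2, hN2⟩ := exists_nat_gt (D / η)
  refine ⟨max (max N1 N2) 2, fun j hj p q hp hq => ?_⟩
  have j1 : N1 ≤ j := (le_max_left _ _).trans ((le_max_left _ _).trans hj)
  have j2 : N2 ≤ j := (le_max_right _ _).trans ((le_max_left _ _).trans hj)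
  have j3 : 2 ≤ j := (le_max_right _ _).trans hj
  have j3' : (2:ℝ) ≤ j := by exact_mod_cast j3
  have jpos : (0:ℝ) < j := by linarith
  have hlow := hlower j (by omega)
  obtain ⟨hcj, hiij, hij, hmj, hccj⟩ := hF j
  have hpt : ∀ t ∈ Set.Icc t₀ t₁, |1 / f j t - 1 / finf t| ≤ 2 / c1 ^ 2 * |f j t - finf t| := by
    intro t ht
    have p1 := hfpos j t ht
    have p2 := hfinfpos t ht
    have p3 : c1 / 2 ≤ f j t := by
      have q1 := hlow t ht
      have q2 : 1 / (j:ℝ) ≤ 1 / 2 := one_div_le_one_div_of_le two_pos j3'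
      have q3 := hmin' t ht
      nlinarith
    have e : 1 / f j t - 1 / finf t = (finf t - f j t) / (f j t * finf t) := by
      field_simp
    rw [e, abs_div, abs_sub_comm, abs_of_pos (mul_pos p1 p2), div_mul_eq_mul_div,
      div_le_div_iff₀ (by positivity) (by positivity)]
    have : c1 / 2 * c1 ≤ f j t * finf t := mul_le_mul p3 (hmin' t ht) c1pos.le p1.le
    have := mul_le_mul_of_nonneg_left this (abs_nonneg (f j t - finf t))
    linarith
  have habsii : ∀ u ∈ Set.Icc t₀ t₁, ∀ v ∈ Set.Icc t₀ t₁,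
      IntervalIntegrable (fun t => |f j t - finf t|) volume u v := fun u hu v hv =>
    ((((hfc j).sub hfinfc).abs).mono (Set.uIcc_subset_Icc hu hv)).intervalIntegrable
  have hclose' : ∀ u ∈ Set.Icc t₀ t₁, ∀ v ∈ Set.Icc t₀ t₁, u ≤ v →
      |(K j v - K j u) - (H v - H u)| ≤ η := by
    intro u hu v hv huv
    rw [← hi u hu v hv, ← hij u hu v hv, ← intervalIntegral.integral_sub (hiij u hu v hv) (hii u hu v hv)]
    refine (intervalIntegral.abs_integral_le_integral_abs huv).trans ?_
    have s1 := intervalIntegral.integral_mono_on huv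
      (((hiij u hu v hv).sub (hii u hu v hv)).abs) ((habsii u hu v hv).const_mul (2 / c1 ^ 2))
      (fun t ht => hpt t ⟨hu.1.trans ht.1, ht.2.trans hv.2⟩)
    refine s1.trans ?_
    rw [intervalIntegral.integral_const_mul]
    refine le_trans ?_ (hN1 j j1).le
    refine mul_le_mul_of_nonneg_left ?_ (by positivity)
    exact intervalIntegral.integral_mono_interval hu.1 huv hv.2
      (Filter.Eventually.of_forall fun t => abs_nonneg _) (habsii t₀ h0 t₁ h1)
  have hclose : ∀ u ∈ Set.Icc t₀ t₁, ∀ v ∈ Set.Icc t₀ t₁,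
      |(K j v - K j u) - (H v - H u)| ≤ η := by
    intro u hu v hv
    rcases le_total u v with h | h
    · exact hclose' u hu v hv h
    · have := hclose' v hv u hu h
      rw [← abs_neg] at this
      convert this using 2; ring
  -- comparison
  have hcomp' : ∀ u ∈ Set.Icc t₀ t₁, ∀ v ∈ Set.Icc t₀ t₁, u ≤ v →
      (1 - 1 / (j:ℝ)) * (K j v - K j u) ≤ H v - H u := by
    intro u hu v hv huv
    rw [← hi u hu v hv, ← hij u hu v hv, ← intervalIntegral.integral_const_mul]
    refine intervalIntegral.integral_mono_on huv ((hiij u hu v hv).const_mul _) (hii u hu v hv) ?_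
    intro t ht
    have ht' : t ∈ Set.Icc t₀ t₁ := ⟨hu.1.trans ht.1, ht.2.trans hv.2⟩
    rw [mul_one_div, div_le_div_iff₀ (hfpos j t ht') (hfinfpos t ht'), one_mul]
    exact hlow t ht'
  have hcomp : ∀ u ∈ Set.Icc t₀ t₁, ∀ v ∈ Set.Icc t₀ t₁,
      (1 - 1 / (j:ℝ)) * |K j v - K j u| ≤ |H v - H u| := by
    intro u hu v hv
    rcases le_total u v with h | h
    · have a1 := hmj hu hv h
      have a2 := hm hu hv h
      rw [abs_of_nonneg (by simp only [hK]; simp only at a1; linarith),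
        abs_of_nonneg (by linarith)]
      exact hcomp' u hu v hv h
    · have a1 := hmj hv hu h
      have a2 := hm hv hu h
      rw [abs_sub_comm (K j v), abs_sub_comm (H v),
        abs_of_nonneg (by simp only [hK]; simp only at a1; linarith),
        abs_of_nonneg (by linarith)]
      exact hcomp' v hv u hu h
  obtain ⟨hne, hdC⟩ := hbase p q hp hq
  -- first inequality
  obtain ⟨P, hP⟩ := exists_near hne (show 0 < ε / 2 by linarith)
  obtain ⟨I, hZ, hI⟩ := P.toZZ hm hi
  obtain ⟨L', I', hZ', hL', hI'⟩ := himp (K j) hclose _ _ _ _ hZ (by linarith)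
  obtain ⟨⟨Q, -⟩, hle1⟩ := nullDist_le_of_ZZ hLS hmj hccj hij hZ' (by linarith)
  -- second inequality
  obtain ⟨P2, hP2⟩ := exists_near ⟨Q⟩ (show 0 < ε / 2 by linarith)
  obtain ⟨I2, hZ2, hI2⟩ := P2.toZZ hmj hij
  obtain ⟨I3, hZ3, hI3⟩ := hZ2.change hcomp
  obtain ⟨L4, I4, hZ4, hL4, hI4⟩ := himp H (fun u _ v _ => by rw [sub_self, abs_zero]; exact ηpos.le) _ _ _ _ hZ3
    (by linarith)
  obtain ⟨-, hle2⟩ := nullDist_le_of_ZZ hLS hm hcc hi hZ4 (by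
    have a1 : (1 - 1 / (j:ℝ)) * dist p.2 q.2 ≤ (1 - 1 / (j:ℝ)) * I2 := by
      refine mul_le_mul_of_nonneg_left hI2 ?_
      have q2 : 1 / (j:ℝ) ≤ 1 / 2 := one_div_le_one_div_of_le two_pos j3'
      linarith
    have a2 : 1 / (j:ℝ) * dist p.2 q.2 < η := by
      rw [one_div_mul_eq_div, div_lt_iff₀ jpos]
      rw [div_lt_iff₀ ηpos] at hN2
      have : (N2:ℝ) ≤ j := by exact_mod_cast j2
      have := mul_le_mul_of_nonneg_right this ηpos.le
      linarith [hDd p.2 q.2]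
    linarith)
  rw [abs_le]
  constructor <;> linarith

end NullDistPaper

open NullDistPaper Set Filter

/-- **Theorem 1.2 (`thm-MainTheorem t`).**
Let `(Σ,σ)` be a compact, connected (continuous Riemannian, i.e. length) metric
space, `M = [t₀,t₁] × Σ`, `fⱼ : [t₀,t₁] → (0,∞)` continuous and
`gⱼ = -dt² + fⱼ(t)²σ` for `j ∈ ℕ ∪ {∞}`.  If `∫ |fⱼ - f_∞| dt → 0` and
`fⱼ(t) ≥ (1 - 1/j) f_∞(t)` on `[t₀,t₁]`, then the null distances `d̂_{t,gⱼ}`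
with respect to the time function `τ(t,x) = t` converge uniformly to
`d̂_{t,g_∞}` on `M × M`. -/
theorem nullDist_uniform_convergence_of_L1_and_lower_bound_t
    {S : Type*} [MetricSpace S] [CompactSpace S] [ConnectedSpace S]
    (hLS : IsLengthSpace S)
    (t₀ t₁ : ℝ) (hle : t₀ ≤ t₁)
    (f : ℕ → ℝ → ℝ) (finf : ℝ → ℝ)
    (hfc : ∀ j, ContinuousOn (f j) (Set.Icc t₀ t₁))
    (hfinfc : ContinuousOn finf (Set.Icc t₀ t₁))
    (hfpos : ∀ j, ∀ t ∈ Set.Icc t₀ t₁, 0 < f j t)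
    (hfinfpos : ∀ t ∈ Set.Icc t₀ t₁, 0 < finf t)
    (hL1 : Tendsto (fun j => ∫ t in t₀..t₁, |f j t - finf t|) atTop (nhds 0))
    (hlower : ∀ j : ℕ, 1 ≤ j → ∀ t ∈ Set.Icc t₀ t₁, (1 - 1 / (j : ℝ)) * finf t ≤ f j t) :
    ∀ ε > 0, ∃ N : ℕ, ∀ j ≥ N, ∀ p q : ℝ × S,
      p.1 ∈ Set.Icc t₀ t₁ → q.1 ∈ Set.Icc t₀ t₁ →
      |nullDist (tWarp (f j)) (fun p => p.1) t₀ t₁ p q -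
        nullDist (tWarp finf) (fun p => p.1) t₀ t₁ p q| ≤ ε := by
  rcases hle.eq_or_lt with heq | hlt
  · exact nullDist_degenerate t₀ t₁ heq f finf
  exact nullDist_main hLS t₀ t₁ hlt f finf hfc hfinfc hfpos hfinfpos hL1 hlower
end

section
/- Let I be a closed interval, (Σ,σ) a compact Riemannian manifold, and (I × Σ, g = −dt² + f(t)²σ) a warped product spacetime. If τ is the time function defined by τ(t,x) = φ(t) with φ′ > 0, then there exists a constant C > 0 such that (1/C) d̂_{t,g}(p,q) ≤ d̂_{τ,g}(p,q) ≤ C d̂_{t,g}(p,q) for all p, q ∈ I × Σ. -/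
open Set MeasureTheory Filter Topology

open NullDistPaper Set Filter

theorem nullDist_le_mul_aux {S : Type*} [PseudoMetricSpace S] (f : ℝ → S → ℝ)
    (τ τ' : ℝ × S → ℝ) (t₀ t₁ C : ℝ) (hC : 0 < C)
    (h : ∀ a b : ℝ × S, a.1 ∈ Set.Icc t₀ t₁ → b.1 ∈ Set.Icc t₀ t₁ →
      |τ b - τ a| ≤ C * |τ' b - τ' a|) (p q : ℝ × S) :
    nullDist f τ t₀ t₁ p q ≤ C * nullDist f τ' t₀ t₁ p q := by
  have key : ∀ γ : PiecewiseCausal f t₀ t₁ p q, nullLength τ γ ≤ C * nullLength τ' γ := by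
    intro γ
    unfold nullLength
    rw [Finset.mul_sum]
    refine Finset.sum_le_sum fun i hi => ?_
    have hi' := Finset.mem_range.1 hi
    exact h _ _ (γ.hstrip i hi'.le) (γ.hstrip (i + 1) hi')
  by_cases hne : Nonempty (PiecewiseCausal f t₀ t₁ p q)
  · obtain ⟨γ₀⟩ := hne
    rw [← div_le_iff₀' hC]
    refine le_csInf ⟨_, γ₀, rfl⟩ ?_
    rintro L ⟨γ, rfl⟩
    rw [div_le_iff₀' hC]
    refine le_trans (csInf_le ⟨0, ?_⟩ ⟨γ, rfl⟩) (key γ)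
    rintro L ⟨γ', rfl⟩
    exact Finset.sum_nonneg fun i _ => abs_nonneg _
  · have e : ∀ τ : ℝ × S → ℝ, nullDist f τ t₀ t₁ p q = 0 := by
      intro τ
      have : {L : ℝ | ∃ γ : PiecewiseCausal f t₀ t₁ p q, L = nullLength τ γ} = ∅ := by
        ext L
        simp only [Set.mem_setOf_eq, Set.mem_empty_iff_false, iff_false]
        rintro ⟨γ, _⟩
        exact hne ⟨γ⟩
      unfold nullDist
      rw [this, Real.sInf_empty]
    simp [e]

/-- **Lemma 2.1 of Allen–Burtscher (`lem:timeequiv`).**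
Let `I = [t₀,t₁]` be a closed interval, `(Σ,σ)` a compact (Riemannian, i.e.
length) metric space and `(I × Σ, g = -dt² + f(t)²σ)` a warped product
spacetime.  If `τ` is the time function `τ(t,x) = φ(t)` with `φ' > 0`, then
there is a constant `C > 0` with
`(1/C)·d̂_{t,g}(p,q) ≤ d̂_{τ,g}(p,q) ≤ C·d̂_{t,g}(p,q)` for all `p,q ∈ I × Σ`. -/
theorem nullDist_time_function_biLipschitz
    {S : Type*} [MetricSpace S] [CompactSpace S]
    (hLS : IsLengthSpace S)
    (t₀ t₁ : ℝ) (hle : t₀ ≤ t₁)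
    (f : ℝ → ℝ) (hfc : ContinuousOn f (Set.Icc t₀ t₁))
    (hfpos : ∀ t ∈ Set.Icc t₀ t₁, 0 < f t)
    (φ φ' : ℝ → ℝ)
    (hφ : ∀ t ∈ Set.Icc t₀ t₁, HasDerivAt φ (φ' t) t)
    (hφ'pos : ∀ t ∈ Set.Icc t₀ t₁, 0 < φ' t)
    (hφ'c : ContinuousOn φ' (Set.Icc t₀ t₁)) :
    ∃ C > 0, ∀ p q : ℝ × S, p.1 ∈ Set.Icc t₀ t₁ → q.1 ∈ Set.Icc t₀ t₁ →
      (1 / C) * nullDist (tWarp f) (fun p => p.1) t₀ t₁ p q ≤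
        nullDist (tWarp f) (fun p => φ p.1) t₀ t₁ p q ∧
      nullDist (tWarp f) (fun p => φ p.1) t₀ t₁ p q ≤
        C * nullDist (tWarp f) (fun p => p.1) t₀ t₁ p q := by
  obtain ⟨u, hu, hmin⟩ := isCompact_Icc.exists_isMinOn (Set.nonempty_Icc.2 hle) hφ'c
  obtain ⟨v, hv, hmax⟩ := isCompact_Icc.exists_isMaxOn (Set.nonempty_Icc.2 hle) hφ'c
  have hm := hφ'pos u hu
  have hM := hφ'pos v hv
  have mvt : ∀ a b : ℝ, a ∈ Set.Icc t₀ t₁ → b ∈ Set.Icc t₀ t₁ →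
      ∃ c ∈ Set.Icc t₀ t₁, φ b - φ a = φ' c * (b - a) := by
    have base : ∀ a b : ℝ, a < b → a ∈ Set.Icc t₀ t₁ → b ∈ Set.Icc t₀ t₁ →
        ∃ c ∈ Set.Icc t₀ t₁, φ b - φ a = φ' c * (b - a) := by
      intro a b hab ha hb
      have hs : ∀ x ∈ Set.Icc a b, x ∈ Set.Icc t₀ t₁ := fun x hx =>
        ⟨ha.1.trans hx.1, hx.2.trans hb.2⟩
      obtain ⟨c, hc, e⟩ := exists_hasDerivAt_eq_slope φ φ' hab
        (fun x hx => (hφ x (hs x hx)).continuousAt.continuousWithinAt)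
        (fun x hx => hφ x (hs x (Set.Ioo_subset_Icc_self hx)))
      refine ⟨c, hs c (Set.Ioo_subset_Icc_self hc), ?_⟩
      rw [e, div_mul_cancel₀ _ (sub_pos.2 hab).ne']
    intro a b ha hb
    rcases lt_trichotomy a b with h | h | h
    · exact base a b h ha hb
    · subst h
      exact ⟨a, ha, by simp⟩
    · obtain ⟨c, hc, e⟩ := base b a h hb ha
      exact ⟨c, hc, by linarith⟩
  have hC : 0 < max (φ' v) (1 / φ' u) := lt_max_of_lt_left hM
  refine ⟨max (φ' v) (1 / φ' u), hC, fun p q _ _ => ⟨?_, ?_⟩⟩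
  · rw [one_div_mul_eq_div, div_le_iff₀' hC]
    refine nullDist_le_mul_aux _ _ _ _ _ _ hC (fun a b ha hb => ?_) p q
    obtain ⟨c, hc, e⟩ := mvt a.1 b.1 ha hb
    have h1 : φ' u ≤ φ' c := hmin hc
    have h2 : 1 ≤ max (φ' v) (1 / φ' u) * φ' c := by
      calc (1 : ℝ) = 1 / φ' u * φ' u := by field_simp
        _ ≤ _ := mul_le_mul (le_max_right _ _) h1 hm.le hC.le
    simp only [e, abs_mul, abs_of_pos (hφ'pos c hc)]
    rw [← mul_assoc]
    exact le_mul_of_one_le_left (abs_nonneg _) h2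
  · refine nullDist_le_mul_aux _ _ _ _ _ _ hC (fun a b ha hb => ?_) p q
    obtain ⟨c, hc, e⟩ := mvt a.1 b.1 ha hb
    have h1 : φ' c ≤ φ' v := hmax hc
    simp only [e, abs_mul, abs_of_pos (hφ'pos c hc)]
    exact mul_le_mul_of_nonneg_right (h1.trans (le_max_left _ _)) (abs_nonneg _)
end

section
/- Let (Σ,σ) be a connected continuous Riemannian manifold and consider the Lorentzian product (M = [t₀,t₁] × Σ, g = −dt² + σ). Then the null distance with respect to the time function t satisfies: d̂_{t,g}(p,q) = |t(p) − t(q)| if q ∈ J^±_g(p), and d̂_{t,g}(p,q) = d_σ(p_Σ, q_Σ) if q ∉ J^±_g(p). -/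
open Set MeasureTheory Filter Topology

open NullDistPaper Set Filter

namespace NullDistPaper

theorem lsc_aux {S : Type*} [MetricSpace S] (G : ℝ → S) (hG : Continuous G) (t0 : ℝ)
    (v : ENNReal) (hv : v < eVariationOn G (Iic t0)) :
    ∀ᶠ t in nhds t0, v < eVariationOn G (Iic t) := by
  have h1 : eVariationOn G (Iic t0) ≤ eVariationOn (fun s => G (min s t0)) univ := by
    have : eVariationOn G (Iic t0) = eVariationOn (fun s => G (min s t0)) (Iic t0) := by
      apply eVariationOn.congr
      intro s hs
      simp only [mem_Iic] at hs
      simp [min_eq_left hs]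
    rw [this]
    exact eVariationOn.mono _ (subset_univ _)
  have h2 := eVariationOn.lowerSemicontinuous_aux (F := fun t s => G (min s t)) (p := nhds t0)
    (f := fun s => G (min s t0)) (s := univ)
    (by
      intro s _
      have : Continuous fun t => G (min s t) := by fun_prop
      exact this.tendsto t0) (lt_of_lt_of_le hv h1)
  filter_upwards [h2] with t ht
  refine lt_of_lt_of_le ht ?_
  refine eVariationOn.comp_le_of_monotoneOn G (fun s => min s t) ?_ ?_
  · intro a _ b _ hab
    exact min_le_min_right _ hab
  · intro a _
    simp

theorem lsc_aux' {S : Type*} [MetricSpace S] (G : ℝ → S) (hG : Continuous G) (t0 : ℝ)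
    (v : ENNReal) (hv : v < eVariationOn G (Ici t0)) :
    ∀ᶠ t in nhds t0, v < eVariationOn G (Ici t) := by
  have h1 : eVariationOn G (Ici t0) ≤ eVariationOn (fun s => G (max s t0)) univ := by
    have : eVariationOn G (Ici t0) = eVariationOn (fun s => G (max s t0)) (Ici t0) := by
      apply eVariationOn.congr
      intro s hs
      simp only [mem_Ici] at hs
      simp [max_eq_left hs]
    rw [this]
    exact eVariationOn.mono _ (subset_univ _)
  have h2 := eVariationOn.lowerSemicontinuous_aux (F := fun t s => G (max s t)) (p := nhds t0)
    (f := fun s => G (max s t0)) (s := univ)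
    (by
      intro s _
      have : Continuous fun t => G (max s t) := by fun_prop
      exact this.tendsto t0) (lt_of_lt_of_le hv h1)
  filter_upwards [h2] with t ht
  refine lt_of_lt_of_le ht ?_
  refine eVariationOn.comp_le_of_monotoneOn G (fun s => max s t) ?_ ?_
  · intro a _ b _ hab
    exact max_le_max_right _ hab
  · intro a _
    simp

theorem cont_aux {S : Type*} [MetricSpace S] (G : ℝ → S) (hG : Continuous G)
    (hb : eVariationOn G univ ≠ ⊤) :
    Continuous fun t => (eVariationOn G (Iic t)).toReal := by
  have hV : ∀ t, eVariationOn G (Iic t) ≠ ⊤ := fun t =>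
    ne_top_of_le_ne_top hb (eVariationOn.mono _ (subset_univ _))
  have hW : ∀ t, eVariationOn G (Ici t) ≠ ⊤ := fun t =>
    ne_top_of_le_ne_top hb (eVariationOn.mono _ (subset_univ _))
  have hsum : ∀ t, (eVariationOn G (Iic t)).toReal + (eVariationOn G (Ici t)).toReal
      = (eVariationOn G univ).toReal := by
    intro t
    rw [← ENNReal.toReal_add (hV t) (hW t),
      ← eVariationOn.union G (x := t) isGreatest_Iic isLeast_Ici, Iic_union_Ici]
  rw [continuous_iff_continuousAt]
  intro t0
  have key : ∀ (H : ℝ → ENNReal), (∀ t, H t ≠ ⊤) →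
      (∀ v, v < H t0 → ∀ᶠ t in nhds t0, v < H t) → ∀ a : ℝ, a < (H t0).toReal →
      ∀ᶠ t in nhds t0, a < (H t).toReal := by
    intro H hH h a ha
    rcases lt_or_ge a 0 with h0 | h0
    · exact Eventually.of_forall fun t => lt_of_lt_of_le h0 ENNReal.toReal_nonneg
    · have := h (ENNReal.ofReal a) ((ENNReal.ofReal_lt_iff_lt_toReal h0 (hH _)).2 ha)
      filter_upwards [this] with t ht
      exact (ENNReal.ofReal_lt_iff_lt_toReal h0 (hH _)).1 ht
  refine tendsto_order.2 ⟨fun a ha => key _ hV (lsc_aux G hG t0) a ha, fun a ha => ?_⟩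
  have h0 := hsum t0
  have := key _ hW (lsc_aux' G hG t0) ((eVariationOn G univ).toReal - a) (by linarith)
  filter_upwards [this] with t ht
  have h0 := hsum t
  linarith

theorem exists_lip {S : Type*} [MetricSpace S] (hLS : IsLengthSpace S) (x y : S) (L : ℝ)
    (hL : dist x y < L) :
    ∃ X : ℝ → S, LipschitzWith 1 X ∧ X 0 = x ∧ X L = y := by
  obtain ⟨γ, g0, g1, gc, gv⟩ := hLS x y (L - dist x y) (by linarith)
  have hL0 : 0 < L := lt_of_le_of_lt dist_nonneg hL
  rw [add_sub_cancel] at gv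
  set G : ℝ → S := fun t => γ (max 0 (min 1 t)) with hGdef
  have hmem : ∀ t : ℝ, max 0 (min 1 t) ∈ Icc (0:ℝ) 1 := fun t =>
    ⟨le_max_left _ _, max_le zero_le_one (min_le_left _ _)⟩
  have hG : Continuous G := gc.comp_continuous (by fun_prop) hmem
  have hGv : eVariationOn G univ ≤ ENNReal.ofReal L := by
    refine le_trans ?_ gv
    refine eVariationOn.comp_le_of_monotoneOn γ (fun t => max 0 (min 1 t)) ?_ (fun t _ => hmem t)
    intro a _ b _ hab
    exact max_le_max_left _ (min_le_min_left _ hab)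
  have hb : eVariationOn G univ ≠ ⊤ := ne_top_of_le_ne_top ENNReal.ofReal_ne_top hGv
  have hV : ∀ s : Set ℝ, eVariationOn G s ≠ ⊤ := fun t =>
    ne_top_of_le_ne_top hb (eVariationOn.mono _ (subset_univ _))
  have hc := cont_aux G hG hb
  set φ : ℝ → ℝ := fun t => (eVariationOn G (Iic t)).toReal with hφ
  have hd : ∀ s t, s ≤ t → dist (G s) (G t) ≤ φ t - φ s := by
    intro s t hst
    have h1 : eVariationOn G (Iic t) = eVariationOn G (Iic s) + eVariationOn G (Icc s t) := by
      rw [← eVariationOn.union G (x := s) isGreatest_Iic (isLeast_Icc hst),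
        Iic_union_Icc_eq_Iic hst]
    have h2 : φ t = φ s + (eVariationOn G (Icc s t)).toReal := by
      simp only [hφ]
      rw [h1, ENNReal.toReal_add (hV _) (hV _)]
    have h3 := BoundedVariationOn.dist_le (hV (Icc s t)) (left_mem_Icc.2 hst) (right_mem_Icc.2 hst)
    linarith
  have hd' : ∀ s t, dist (G s) (G t) ≤ |φ s - φ t| := by
    intro s t
    rcases le_total s t with h | h
    · rw [abs_sub_comm]
      exact (hd s t h).trans (le_abs_self _)
    · rw [dist_comm]
      exact (hd t s h).trans (le_abs_self _)
  have hφ0 : φ 0 = 0 := by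
    have : eVariationOn G (Iic 0) = 0 := by
      apply eVariationOn.constant_on
      rintro _ ⟨a, ha, rfl⟩ _ ⟨b, hb, rfl⟩
      simp only [mem_Iic] at ha hb
      simp only [hGdef]
      rw [max_eq_left ((min_le_right _ _).trans ha), max_eq_left ((min_le_right _ _).trans hb)]
    simp [hφ, this]
  have hφL : φ 1 ≤ L := by
    refine ENNReal.toReal_le_of_le_ofReal hL0.le (le_trans ?_ hGv)
    exact eVariationOn.mono _ (subset_univ _)
  have hφ1 : 0 ≤ φ 1 := ENNReal.toReal_nonneg
  have hex : ∀ u : ℝ, ∃ t : ℝ, φ t = max 0 (min (φ 1) u) := by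
    intro u
    have := intermediate_value_Icc (zero_le_one (α := ℝ)) hc.continuousOn
      (show max 0 (min (φ 1) u) ∈ Icc (φ 0) (φ 1) by
        rw [hφ0]; exact ⟨le_max_left _ _, max_le hφ1 (min_le_left _ _)⟩)
    obtain ⟨t, _, ht⟩ := this
    exact ⟨t, ht⟩
  choose s hs using hex
  have heq : ∀ a b, φ a = φ b → G a = G b := by
    intro a b h
    have := hd' a b
    rw [h, sub_self, abs_zero] at this
    exact dist_le_zero.1 this
  refine ⟨fun u => G (s u), ?_, ?_, ?_⟩
  · refine LipschitzWith.of_dist_le_mul fun u v => ?_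
    refine (hd' _ _).trans ?_
    rw [hs, hs, NNReal.coe_one, one_mul, Real.dist_eq]
    refine (abs_max_sub_max_le_max _ _ _ _).trans ?_
    rw [sub_self, abs_zero]
    refine max_le (abs_nonneg _) ((abs_min_sub_min_le_max _ _ _ _).trans ?_)
    rw [sub_self, abs_zero]
    exact max_le (abs_nonneg _) le_rfl
  · have : G (s 0) = G 0 := heq _ _ (by rw [hs, hφ0, min_eq_right hφ1, max_self])
    simp only [this]
    simp [hGdef, g0]
  · have : G (s L) = G 1 := heq _ _ (by rw [hs, min_eq_left hφL, max_eq_right hφ1])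
    simp only [this]
    simp [hGdef, g1]

theorem related_of_lip {S : Type*} [MetricSpace S] (X : ℝ → S) (hX : LipschitzWith 1 X)
    (s s' u v : ℝ) (h : |s - s'| = |u - v|) :
    CausallyRelated (tWarp fun _ => (1:ℝ)) (s, X u) (s', X v) := by
  wlog hss : s ≤ s' generalizing s s' u v
  · have := this s' s v u (by rw [abs_sub_comm, h, abs_sub_comm]) (le_of_not_ge hss)
    exact Or.symm this
  left
  obtain ⟨e, he, hv⟩ : ∃ e : ℝ, |e| = 1 ∧ v = u + e * (s' - s) := by
    rw [abs_sub_comm, abs_of_nonneg (sub_nonneg.2 hss)] at h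
    rcases abs_choice (u - v) with h' | h'
    · exact ⟨-1, by simp, by linarith⟩
    · exact ⟨1, by simp, by linarith⟩
  have hY : LipschitzWith 1 fun t => X (u + e * (t - s)) := by
    refine LipschitzWith.of_dist_le_mul fun a b => ?_
    refine (hX.dist_le_mul _ _).trans ?_
    simp only [NNReal.coe_one, one_mul, Real.dist_eq]
    rw [show u + e * (a - s) - (u + e * (b - s)) = e * (a - b) by ring, abs_mul, he, one_mul]
  refine ⟨hss, fun t => X (u + e * (t - s)), by simp, by simp [hv], hss,
    hY.continuous.continuousOn, ?_⟩
  intro c _ d _ _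
  have := (hY.lipschitzOnWith (s := univ)).comp_eVariationOn_le (g := id) (s := Icc c d)
    (mapsTo_univ _ _)
  rw [eVariationOn_id_Icc] at this
  simpa [tWarp] using this

theorem dist_le_of_related {S : Type*} [MetricSpace S] (p q : ℝ × S)
    (h : CausallyRelated (tWarp fun _ => (1:ℝ)) p q) : dist p.2 q.2 ≤ |p.1 - q.1| := by
  have key : ∀ p q : ℝ × S, FutureRelated (tWarp fun _ => (1:ℝ)) p q →
      dist p.2 q.2 ≤ |p.1 - q.1| := by
    rintro p q ⟨hpq, x, h1, h2, -, -, h3⟩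
    have h4 := h3 p.1 (left_mem_Icc.2 hpq) q.1 (right_mem_Icc.2 hpq) hpq
    have h5 := (eVariationOn.edist_le x (left_mem_Icc.2 hpq) (right_mem_Icc.2 hpq)).trans h4
    rw [h1, h2, edist_dist] at h5
    simp only [tWarp, div_one, intervalIntegral.integral_const, smul_eq_mul, mul_one] at h5
    rw [ENNReal.ofReal_le_ofReal_iff (sub_nonneg.2 hpq)] at h5
    rw [abs_sub_comm]
    exact h5.trans (le_abs_self _)
  rcases h with h | h
  · exact key p q h
  · rw [dist_comm, abs_sub_comm]
    exact key q p h

theorem nullLength_ge_time {S : Type*} [MetricSpace S] {t₀ t₁ : ℝ} {p q : ℝ × S}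
    (γ : PiecewiseCausal (tWarp fun _ => (1:ℝ)) t₀ t₁ p q) :
    |p.1 - q.1| ≤ nullLength (fun p => p.1) γ := by
  have := dist_le_range_sum_dist (fun i => (γ.pt i).1) γ.k
  rw [γ.h0, γ.hlast, Real.dist_eq] at this
  refine this.trans (le_of_eq ?_)
  unfold nullLength
  refine Finset.sum_congr rfl fun i _ => ?_
  rw [Real.dist_eq, abs_sub_comm]

theorem nullLength_ge_dist {S : Type*} [MetricSpace S] {t₀ t₁ : ℝ} {p q : ℝ × S}
    (γ : PiecewiseCausal (tWarp fun _ => (1:ℝ)) t₀ t₁ p q) :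
    dist p.2 q.2 ≤ nullLength (fun p => p.1) γ := by
  have := dist_le_range_sum_dist (fun i => (γ.pt i).2) γ.k
  rw [γ.h0, γ.hlast] at this
  refine this.trans ?_
  unfold nullLength
  refine Finset.sum_le_sum fun i hi => ?_
  rw [abs_sub_comm]
  exact dist_le_of_related _ _ (γ.piece i (Finset.mem_range.1 hi))

theorem exists_zigzag {S : Type*} [MetricSpace S] {t₀ t₁ : ℝ} (hlt : t₀ < t₁) (p q : ℝ × S)
    (hp : p.1 ∈ Set.Icc t₀ t₁) (hq : q.1 ∈ Set.Icc t₀ t₁) (X : ℝ → S) (hX : LipschitzWith 1 X)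
    (L : ℝ) (h0 : X 0 = p.2) (h1 : X L = q.2) (hL : |p.1 - q.1| ≤ L) :
    ∃ γ : PiecewiseCausal (tWarp fun _ => (1:ℝ)) t₀ t₁ p q, L = nullLength (fun p => p.1) γ := by
  set D := |p.1 - q.1| with hD
  obtain ⟨N, hN⟩ := exists_nat_gt ((L - D) / (t₁ - t₀))
  have hN0 : (0:ℝ) < N := lt_of_le_of_lt (div_nonneg (by linarith) (by linarith)) hN
  rw [div_lt_iff₀ (by linarith)] at hN
  set δ := (L - D) / (2 * N) with hδ
  have hδN : 2 * N * δ = L - D := by rw [hδ]; field_simp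
  have hδ0 : 0 ≤ δ := div_nonneg (by linarith) (by linarith)
  have hδ1 : δ ≤ (t₁ - t₀) / 2 := by
    rw [hδ, div_le_iff₀ (by linarith)]
    linarith
  obtain ⟨e, he, hes⟩ : ∃ e : ℝ, |e| = δ ∧ q.1 + e ∈ Icc t₀ t₁ := by
    rcases le_total (q.1 + δ) t₁ with h | h
    · exact ⟨δ, abs_of_nonneg hδ0, by linarith [hq.1], h⟩
    · exact ⟨-δ, by rw [abs_neg, abs_of_nonneg hδ0], by linarith, by linarith [hq.2]⟩
  let T : ℕ → ℝ := fun j => q.1 + if j % 2 = 0 then 0 else e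
  have hT0 : T 0 = q.1 := by simp [T]
  have hTs : ∀ j, |T (j + 1) - T j| = δ := by
    intro j
    rcases Nat.mod_two_eq_zero_or_one j with h | h
    · have h' : (j + 1) % 2 = 1 := by omega
      simp [T, h, h', he]
    · have h' : (j + 1) % 2 = 0 := by omega
      simp [T, h, h', he]
  have hTm : ∀ j, T j ∈ Icc t₀ t₁ := by
    intro j
    simp only [T]
    split_ifs
    · simpa using hq
    · exact hes
  let P : ℕ → ℝ × S := fun i => match i with
    | 0 => p
    | j + 1 => (T j, X (D + j * δ))
  let γ : PiecewiseCausal (tWarp fun _ => (1:ℝ)) t₀ t₁ p q :=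
    { k := 2 * N + 1
      hk := by omega
      pt := P
      h0 := rfl
      hlast := by
        have : T (2 * N) = q.1 := by simp [T]
        show (T (2 * N), X (D + ((2 * N : ℕ) : ℝ) * δ)) = q
        rw [this]
        push_cast
        rw [hδN, add_sub_cancel, h1]
      hstrip := by
        intro i _
        cases i with
        | zero => exact hp
        | succ j => exact hTm j
      piece := by
        intro i _
        cases i with
        | zero =>
          show CausallyRelated _ p (T 0, X (D + ((0 : ℕ) : ℝ) * δ))
          have := related_of_lip X hX p.1 (T 0) 0 (D + ((0 : ℕ) : ℝ) * δ) (by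
            simp [hT0, hD])
          rw [h0] at this
          exact this
        | succ j =>
          show CausallyRelated _ (T j, X (D + (j : ℝ) * δ)) (T (j + 1), X (D + ((j + 1 : ℕ) : ℝ) * δ))
          apply related_of_lip X hX
          rw [abs_sub_comm, hTs, abs_sub_comm]
          push_cast
          rw [show D + ((j : ℝ) + 1) * δ - (D + j * δ) = δ by ring, abs_of_nonneg hδ0] }
  refine ⟨γ, ?_⟩
  show L = ∑ i ∈ Finset.range (2 * N + 1), |(P (i + 1)).1 - (P i).1|
  rw [Finset.sum_range_succ']
  have : ∀ i, |(P (i + 1 + 1)).1 - (P (i + 1)).1| = δ := hTs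
  simp only [this]
  have h2 : |(P (0 + 1)).1 - (P 0).1| = D := by
    show |T 0 - p.1| = D
    rw [hT0, abs_sub_comm]
  rw [h2]
  simp only [Finset.sum_const, Finset.card_range, nsmul_eq_mul]
  push_cast
  linarith

end NullDistPaper

/-- **Proposition 3.3 of Sormani–Vega / Lemma 4.4 of Allen–Burtscher
(`lem:nulld1`).**  Let `(Σ,σ)` be a connected (continuous Riemannian, i.e.
length) metric space and `(M = [t₀,t₁] × Σ, g = -dt² + σ)` the Lorentzian
product.  Then the null distance w.r.t. the time function `t` satisfies
`d̂_{t,g}(p,q) = |t(p) - t(q)|` if `q ∈ J^±_g(p)`, and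
`d̂_{t,g}(p,q) = d_σ(p_Σ, q_Σ)` if `q ∉ J^±_g(p)`. -/
theorem nullDist_minkowski_product
    {S : Type*} [MetricSpace S] [ConnectedSpace S]
    (hLS : IsLengthSpace S)
    (t₀ t₁ : ℝ) (hlt : t₀ < t₁)
    (p q : ℝ × S) (hp : p.1 ∈ Set.Icc t₀ t₁) (hq : q.1 ∈ Set.Icc t₀ t₁) :
    (CausallyRelated (tWarp fun _ => (1:ℝ)) p q →
      nullDist (tWarp fun _ => (1:ℝ)) (fun p => p.1) t₀ t₁ p q = |p.1 - q.1|) ∧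
    (¬ CausallyRelated (tWarp fun _ => (1:ℝ)) p q →
      nullDist (tWarp fun _ => (1:ℝ)) (fun p => p.1) t₀ t₁ p q = dist p.2 q.2) := by
  refine ⟨fun h => ?_, fun h => ?_⟩
  · apply IsLeast.csInf_eq
    refine ⟨⟨⟨1, one_pos, fun i => if i = 0 then p else q, by simp, by simp, ?_, ?_⟩, ?_⟩, ?_⟩
    · intro i _
      by_cases hi : i = 0
      · simpa [hi] using hp
      · simpa [hi] using hq
    · intro i hi
      obtain rfl : i = 0 := by omega
      simpa using h
    · simp [nullLength, abs_sub_comm]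
    · rintro _ ⟨γ, rfl⟩
      exact nullLength_ge_time γ
  · have hd : |p.1 - q.1| ≤ dist p.2 q.2 := by
      by_contra hcon
      obtain ⟨X, hX, h0, h1⟩ := exists_lip hLS p.2 q.2 _ (not_le.1 hcon)
      have := related_of_lip X hX p.1 q.1 0 |p.1 - q.1| (by simp)
      rw [h0, h1] at this
      exact h this
    have hex : ∀ L, dist p.2 q.2 < L → ∃ γ : PiecewiseCausal (tWarp fun _ => (1:ℝ)) t₀ t₁ p q,
        L = nullLength (fun p => p.1) γ := by
      intro L hL
      obtain ⟨X, hX, h0, h1⟩ := exists_lip hLS p.2 q.2 L hL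
      exact exists_zigzag hlt p q hp hq X hX L h0 h1 (by linarith)
    apply csInf_eq_of_forall_ge_of_forall_gt_exists_lt
    · exact ⟨_, hex (dist p.2 q.2 + 1) (by linarith)⟩
    · rintro _ ⟨γ, rfl⟩
      exact nullLength_ge_dist γ
    · intro w hw
      obtain ⟨L, hL1, hL2⟩ := exists_between hw
      exact ⟨L, hex L hL1, hL2⟩
end

section
/- Let (Σ,σ) be a connected, continuous Riemannian manifold and f : [t₀,t₁] → (0,∞) bounded with 0 < f_min ≤ f(t) ≤ f_max < ∞ for all t ∈ [t₀,t₁]. On M = [t₀,t₁] × Σ consider the Lorentzian metrics g_f = −dt² + f(t)²σ and g = −dt² + σ. Then for all p, q ∈ M: min{1, f_min} · d̂_{t,g}(p,q) ≤ d̂_{t,g_f}(p,q) ≤ max{1, f_max} · d̂_{t,g}(p,q). -/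
open Set MeasureTheory Filter Topology

open NullDistPaper Set Filter

namespace NDAux

lemma dist_le_of_Ioo {S : Type*} [MetricSpace S] (γ : ℝ → S) (u u' K : ℝ) (h : u < u')
    (hc : ContinuousOn γ (Icc u u'))
    (hd : ∀ v ∈ Ioo u u', ∀ v' ∈ Ioo u u', dist (γ v) (γ v') ≤ K) :
    dist (γ u) (γ u') ≤ K := by
  have h1 : Tendsto γ (nhdsWithin u (Ioo u u')) (nhds (γ u)) :=
    (hc u (left_mem_Icc.2 h.le)).mono_left (nhdsWithin_mono _ Ioo_subset_Icc_self)
  have h2 : Tendsto γ (nhdsWithin u' (Ioo u u')) (nhds (γ u')) :=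
    (hc u' (right_mem_Icc.2 h.le)).mono_left (nhdsWithin_mono _ Ioo_subset_Icc_self)
  have n1 : (nhdsWithin u (Ioo u u')).NeBot := by
    rw [← mem_closure_iff_nhdsWithin_neBot, closure_Ioo h.ne]; exact left_mem_Icc.2 h.le
  have n2 : (nhdsWithin u' (Ioo u u')).NeBot := by
    rw [← mem_closure_iff_nhdsWithin_neBot, closure_Ioo h.ne]; exact right_mem_Icc.2 h.le
  have h3 : ∀ v ∈ Ioo u u', dist (γ v) (γ u') ≤ K := fun v hv =>
    le_of_tendsto (tendsto_const_nhds.dist h2)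
      (eventually_mem_nhdsWithin.mono fun v' hv' => hd v hv v' hv')
  exact le_of_tendsto (h1.dist tendsto_const_nhds)
      (eventually_mem_nhdsWithin.mono fun v hv => h3 v hv)

lemma exists_lip {S : Type*} [MetricSpace S] (hLS : IsLengthSpace S) (x y : S) (l : ℝ)
    (hl : dist x y < l) :
    ∃ c : ℝ → S, c 0 = x ∧ c l = y ∧ ∀ s s', dist (c s) (c s') ≤ |s - s'| := by
  obtain ⟨γ, h0, h1, hc, hv⟩ := hLS x y (l - dist x y) (by linarith)
  have hl0 : 0 < l := lt_of_le_of_lt dist_nonneg hl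
  rw [add_sub_cancel] at hv
  set E : ℝ → ENNReal := fun u => eVariationOn γ (Icc 0 u) with hE
  have hfin : ∀ u ≤ 1, E u ≠ ⊤ := fun u hu =>
    ne_top_of_le_ne_top ENNReal.ofReal_ne_top
      ((eVariationOn.mono γ (Icc_subset_Icc le_rfl hu)).trans hv)
  set V : ℝ → ℝ := fun u => (E u).toReal with hV
  have hV0 : ∀ u, 0 ≤ V u := fun u => ENNReal.toReal_nonneg
  have hVl : V 1 ≤ l := ENNReal.toReal_le_of_le_ofReal hl0.le hv
  have hstep : ∀ u u', 0 ≤ u → u ≤ u' → u' ≤ 1 → dist (γ u) (γ u') ≤ V u' - V u := by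
    intro u u' hu huu hu'
    have e1 : E u + eVariationOn γ (Icc u u') ≤ E u' := by
      have := eVariationOn.add_le_union γ (s := Icc 0 u) (t := Icc u u')
        (fun a ha b hb => ha.2.trans hb.1)
      rwa [Icc_union_Icc_eq_Icc hu huu] at this
    have e2 : edist (γ u) (γ u') ≤ eVariationOn γ (Icc u u') :=
      eVariationOn.edist_le γ (left_mem_Icc.2 huu) (right_mem_Icc.2 huu)
    have e3 : E u + edist (γ u) (γ u') ≤ E u' := (add_le_add le_rfl e2).trans e1
    have e4 := ENNReal.toReal_mono (hfin u' hu') e3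
    rw [ENNReal.toReal_add (hfin u (huu.trans hu')) (edist_ne_top _ _), ← dist_edist] at e4
    simp only [hV]; linarith
  have hmono : ∀ u u', 0 ≤ u → u ≤ u' → u' ≤ 1 → V u ≤ V u' := by
    intro u u' hu huu hu'
    have := hstep u u' hu huu hu'
    have := dist_nonneg (x := γ u) (y := γ u')
    linarith
  have key : ∀ u u' s s', 0 ≤ u → u ≤ u' → u' ≤ 1 → s ≤ s' →
      (∀ v ∈ Ioo u u', s ≤ V v ∧ V v ≤ s') → dist (γ u) (γ u') ≤ s' - s := by
    intro u u' s s' hu huu hu' hss hh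
    rcases huu.eq_or_lt with rfl | hlt
    · simpa using hss
    · refine dist_le_of_Ioo γ u u' _ hlt (hc.mono (Icc_subset_Icc hu hu')) ?_
      have aux : ∀ v ∈ Ioo u u', ∀ v' ∈ Ioo u u', v ≤ v' → dist (γ v) (γ v') ≤ s' - s := by
        intro v hv v' hv' hvv
        have := hstep v v' (hu.trans hv.1.le) hvv (hv'.2.le.trans hu')
        have := (hh v hv).1
        have := (hh v' hv').2
        linarith
      intro v hv v' hv'
      rcases le_total v v' with h | h
      · exact aux v hv v' hv' h
      · rw [dist_comm]; exact aux v' hv' v hv h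
  set A : ℝ → Set ℝ := fun s => {u | u ∈ Icc (0:ℝ) 1 ∧ V u ≤ s} with hA
  set φ : ℝ → ℝ := fun s => sSup (A s) with hφ
  have hbdd : ∀ s, BddAbove (A s) := fun s => ⟨1, fun u hu => hu.1.2⟩
  have hV00 : V 0 = 0 := by
    simp only [hV, hE, Icc_self]
    rw [eVariationOn.subsingleton γ subsingleton_singleton]; rfl
  have h0A : ∀ s, 0 ≤ s → (0:ℝ) ∈ A s := fun s hs => ⟨⟨le_rfl, zero_le_one⟩, by rw [hV00]; exact hs⟩
  have hφ0 : ∀ s, 0 ≤ s → 0 ≤ φ s := fun s hs => le_csSup (hbdd s) (h0A s hs)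
  have hφ1 : ∀ s, 0 ≤ s → φ s ≤ 1 := fun s hs => csSup_le ⟨0, h0A s hs⟩ fun u hu => hu.1.2
  have hlow : ∀ s, 0 ≤ s → ∀ v, 0 ≤ v → v < φ s → V v ≤ s := by
    intro s hs v hv hvs
    obtain ⟨w, hw, hvw⟩ := exists_lt_of_lt_csSup ⟨0, h0A s hs⟩ hvs
    exact (hmono v w hv hvw.le hw.1.2).trans hw.2
  have hhigh : ∀ s v, v ≤ 1 → 0 ≤ v → φ s < v → s ≤ V v := by
    intro s v hv1 hv0 hlt
    by_contra hcon
    push Not at hcon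
    exact absurd (le_csSup (hbdd s) (show v ∈ A s from ⟨⟨hv0, hv1⟩, hcon.le⟩)) (not_le.2 hlt)
  have hlip : ∀ s s', 0 ≤ s → s ≤ s' → dist (γ (φ s)) (γ (φ s')) ≤ s' - s := by
    intro s s' hs hss
    have hs' := hs.trans hss
    refine key _ _ s s' (hφ0 s hs) ?_ (hφ1 s' hs') hss ?_
    · exact csSup_le_csSup (hbdd s') ⟨0, h0A s hs⟩ fun u hu => ⟨hu.1, hu.2.trans hss⟩
    · intro v hv
      have hv0 := (hφ0 s hs).trans hv.1.le
      exact ⟨hhigh s v (hv.2.le.trans (hφ1 s' hs')) hv0 hv.1, hlow s' hs' v hv0 hv.2⟩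
  refine ⟨fun s => γ (φ (max s 0)), ?_, ?_, ?_⟩
  · simp only [max_self]
    have := key 0 (φ 0) 0 0 le_rfl (hφ0 0 le_rfl) (hφ1 0 le_rfl) le_rfl
      (fun v hv => ⟨hV0 v, hlow 0 le_rfl v hv.1.le hv.2⟩)
    rw [sub_self] at this
    rw [← h0]; exact (dist_le_zero.1 this).symm
  · simp only [max_eq_left hl0.le]
    have : φ l = 1 := le_antisymm (hφ1 l hl0.le)
      (le_csSup (hbdd l) (show (1:ℝ) ∈ A l from ⟨⟨zero_le_one, le_rfl⟩, hVl⟩))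
    rw [this, h1]
  · have aux : ∀ s s', s ≤ s' → dist (γ (φ (max s 0))) (γ (φ (max s' 0))) ≤ |s - s'| := by
      intro s s' hss
      refine (hlip _ _ (le_max_right _ _) (max_le_max hss le_rfl)).trans ?_
      have := abs_max_sub_max_le_abs s s' 0
      have h2 := neg_abs_le (max s 0 - max s' 0)
      linarith
    intro s s'
    rcases le_total s s' with h | h
    · exact aux s s' h
    · have := aux s' s h
      rwa [dist_comm, abs_sub_comm] at this

section
variable {S : Type*} [MetricSpace S] {t₀ t₁ : ℝ} {f : ℝ → ℝ} {fmin fmax : ℝ}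

lemma integrable_inv (hfc : ContinuousOn f (Icc t₀ t₁)) (hmin : 0 < fmin)
    (hbound : ∀ t ∈ Icc t₀ t₁, fmin ≤ f t ∧ f t ≤ fmax) {c d : ℝ} (hc : c ∈ Icc t₀ t₁)
    (hd : d ∈ Icc t₀ t₁) (hcd : c ≤ d) :
    IntervalIntegrable (fun t => 1 / f t) MeasureTheory.volume c d := by
  have : ContinuousOn (fun t => 1 / f t) (Icc t₀ t₁) :=
    continuousOn_const.div hfc fun t ht => (hmin.trans_le (hbound t ht).1).ne'
  apply ContinuousOn.intervalIntegrable
  rw [uIcc_of_le hcd]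
  exact this.mono (Icc_subset_Icc hc.1 hd.2)

lemma int_bounds (hfc : ContinuousOn f (Icc t₀ t₁)) (hmin : 0 < fmin)
    (hbound : ∀ t ∈ Icc t₀ t₁, fmin ≤ f t ∧ f t ≤ fmax) {c d : ℝ} (hc : c ∈ Icc t₀ t₁)
    (hd : d ∈ Icc t₀ t₁) (hcd : c ≤ d) :
    (d - c) / fmax ≤ ∫ t in c..d, 1 / f t ∧ ∫ t in c..d, 1 / f t ≤ (d - c) / fmin := by
  have hi := integrable_inv hfc hmin hbound hc hd hcd
  constructor
  · have := intervalIntegral.integral_mono_on hcd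
      (intervalIntegrable_const (c := 1 / fmax)) hi (fun t ht => by
        have hb := hbound t ⟨hc.1.trans ht.1, ht.2.trans hd.2⟩
        exact one_div_le_one_div_of_le (hmin.trans_le hb.1) hb.2)
    rw [intervalIntegral.integral_const, smul_eq_mul, mul_one_div] at this
    exact this
  · have := intervalIntegral.integral_mono_on hcd hi
      (intervalIntegrable_const (c := 1 / fmin)) (fun t ht => by
        have hb := hbound t ⟨hc.1.trans ht.1, ht.2.trans hd.2⟩
        exact one_div_le_one_div_of_le hmin hb.1)
    rw [intervalIntegral.integral_const, smul_eq_mul, mul_one_div] at this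
    exact this

lemma future_of_lip (hfc : ContinuousOn f (Icc t₀ t₁)) (hmin : 0 < fmin)
    (hbound : ∀ t ∈ Icc t₀ t₁, fmin ≤ f t ∧ f t ≤ fmax) (hmax : 0 < fmax)
    (p q : ℝ × S) (hp : p.1 ∈ Icc t₀ t₁) (hq : q.1 ∈ Icc t₀ t₁) (hpq : p.1 ≤ q.1)
    (c : ℝ → S) (hc : ∀ s s', dist (c s) (c s') ≤ |s - s'| / fmax)
    (h1 : c p.1 = p.2) (h2 : c q.1 = q.2) : FutureRelated (tWarp f) p q := by
  have hL : LipschitzWith (Real.toNNReal (1 / fmax)) c := by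
    apply LipschitzWith.of_dist_le_mul
    intro s s'
    rw [Real.coe_toNNReal _ (by positivity), Real.dist_eq, one_div, inv_mul_eq_div]
    exact hc s s'
  refine ⟨hpq, c, h1, h2, hpq, hL.continuous.continuousOn, ?_⟩
  intro a ha b hb hab
  have ha' : a ∈ Icc t₀ t₁ := ⟨hp.1.trans ha.1, ha.2.trans hq.2⟩
  have hb' : b ∈ Icc t₀ t₁ := ⟨hp.1.trans hb.1, hb.2.trans hq.2⟩
  have e1 := (hL.lipschitzOnWith (s := univ)).comp_eVariationOn_le (g := id) (s := Icc a b)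
    (fun _ _ => mem_univ _)
  have e2 : eVariationOn (id : ℝ → ℝ) (Icc a b) ≤ ENNReal.ofReal (b - a) := by
    have := (monotone_id.monotoneOn (Icc a b)).eVariationOn_le (left_mem_Icc.2 hab)
      (right_mem_Icc.2 hab)
    rwa [inter_self] at this
  refine (e1.trans (mul_le_mul_right e2 _)).trans ?_
  change ENNReal.ofReal (1 / fmax) * _ ≤ _
  rw [← ENNReal.ofReal_mul (by positivity)]
  apply ENNReal.ofReal_le_ofReal
  have := (int_bounds hfc hmin hbound ha' hb' hab).1
  rw [one_div_mul_eq_div]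
  exact this

lemma causal_of_lip (hfc : ContinuousOn f (Icc t₀ t₁)) (hmin : 0 < fmin)
    (hbound : ∀ t ∈ Icc t₀ t₁, fmin ≤ f t ∧ f t ≤ fmax) (hmax : 0 < fmax)
    (p q : ℝ × S) (hp : p.1 ∈ Icc t₀ t₁) (hq : q.1 ∈ Icc t₀ t₁)
    (c : ℝ → S) (hc : ∀ s s', dist (c s) (c s') ≤ |s - s'| / fmax) (s s' : ℝ)
    (h1 : c s = p.2) (h2 : c s' = q.2) (hs : s' - s = |q.1 - p.1|) :
    CausallyRelated (tWarp f) p q := by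
  rcases le_total p.1 q.1 with h | h
  · left
    rw [abs_of_nonneg (by linarith)] at hs
    refine future_of_lip hfc hmin hbound hmax p q hp hq h (fun r => c (s + (r - p.1))) ?_ ?_ ?_
    · intro a b
      convert hc (s + (a - p.1)) (s + (b - p.1)) using 3
      ring
    · simpa using h1
    · rw [← h2, ← hs]; simp
  · right
    rw [abs_of_nonpos (by linarith)] at hs
    refine future_of_lip hfc hmin hbound hmax q p hq hp h (fun r => c (s + (p.1 - r))) ?_ ?_ ?_
    · intro a b
      convert hc (s + (p.1 - a)) (s + (p.1 - b)) using 2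
      rw [abs_sub_comm]; congr 1; ring
    · rw [← h2]; congr 1; linarith
    · simpa using h1

lemma future_dist (hfc : ContinuousOn f (Icc t₀ t₁)) (hmin : 0 < fmin)
    (hbound : ∀ t ∈ Icc t₀ t₁, fmin ≤ f t ∧ f t ≤ fmax)
    (p q : ℝ × S) (hp : p.1 ∈ Icc t₀ t₁) (hq : q.1 ∈ Icc t₀ t₁)
    (h : FutureRelated (tWarp f) p q) : fmin * dist p.2 q.2 ≤ |q.1 - p.1| := by
  obtain ⟨hpq, x, h1, h2, -, -, hx⟩ := h
  have e1 := hx p.1 (left_mem_Icc.2 hpq) q.1 (right_mem_Icc.2 hpq) hpq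
  have e2 := (eVariationOn.edist_le x (left_mem_Icc.2 hpq) (right_mem_Icc.2 hpq)).trans e1
  have e3 := (int_bounds hfc hmin hbound hp hq hpq).2
  have e4 : edist (x p.1) (x q.1) ≤ ENNReal.ofReal ((q.1 - p.1) / fmin) :=
    e2.trans (ENNReal.ofReal_le_ofReal e3)
  rw [h1, h2, edist_le_ofReal (div_nonneg (by linarith) hmin.le), le_div_iff₀ hmin] at e4
  rw [abs_of_nonneg (by linarith)]; linarith

lemma causal_dist (hfc : ContinuousOn f (Icc t₀ t₁)) (hmin : 0 < fmin)
    (hbound : ∀ t ∈ Icc t₀ t₁, fmin ≤ f t ∧ f t ≤ fmax)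
    (p q : ℝ × S) (hp : p.1 ∈ Icc t₀ t₁) (hq : q.1 ∈ Icc t₀ t₁)
    (h : CausallyRelated (tWarp f) p q) : fmin * dist p.2 q.2 ≤ |q.1 - p.1| := by
  rcases h with h | h
  · exact future_dist hfc hmin hbound p q hp hq h
  · rw [dist_comm, abs_sub_comm]; exact future_dist hfc hmin hbound q p hq hp h

lemma length_lower (hfc : ContinuousOn f (Icc t₀ t₁)) (hmin : 0 < fmin)
    (hbound : ∀ t ∈ Icc t₀ t₁, fmin ≤ f t ∧ f t ≤ fmax)
    (p q : ℝ × S) (γ : PiecewiseCausal (tWarp f) t₀ t₁ p q) :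
    max |q.1 - p.1| (fmin * dist p.2 q.2) ≤ nullLength (fun p => p.1) γ := by
  unfold nullLength
  apply max_le
  · have := dist_le_range_sum_dist (fun i => (γ.pt i).1) γ.k
    simp only [γ.h0, γ.hlast] at this
    rw [dist_comm, Real.dist_eq] at this
    refine this.trans (le_of_eq (Finset.sum_congr rfl fun i _ => ?_))
    rw [dist_comm, Real.dist_eq]
  · have := dist_le_range_sum_dist (fun i => (γ.pt i).2) γ.k
    simp only [γ.h0, γ.hlast] at this
    refine (mul_le_mul_of_nonneg_left this hmin.le).trans ?_
    rw [Finset.mul_sum]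
    refine Finset.sum_le_sum fun i hi => ?_
    have hi := Finset.mem_range.1 hi
    exact causal_dist hfc hmin hbound _ _ (γ.hstrip i hi.le) (γ.hstrip (i+1) hi) (γ.piece i hi)

lemma exists_curve (hLS : IsLengthSpace S) (hlt : t₀ < t₁)
    (hfc : ContinuousOn f (Icc t₀ t₁)) (hmin : 0 < fmin)
    (hbound : ∀ t ∈ Icc t₀ t₁, fmin ≤ f t ∧ f t ≤ fmax) (hmax : 0 < fmax)
    (p q : ℝ × S) (hp : p.1 ∈ Icc t₀ t₁) (hq : q.1 ∈ Icc t₀ t₁) (L : ℝ)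
    (hL : max |q.1 - p.1| (fmax * dist p.2 q.2) < L) :
    ∃ γ : PiecewiseCausal (tWarp f) t₀ t₁ p q, L = nullLength (fun p => p.1) γ := by
  obtain ⟨hL1, hL2⟩ := max_lt_iff.1 hL
  obtain ⟨C, hC0, hC1, hC⟩ := exists_lip hLS p.2 q.2 (L / fmax)
    (by rw [lt_div_iff₀ hmax]; linarith)
  set c : ℝ → S := fun s => C (s / fmax) with hcdef
  have hc : ∀ s s', dist (c s) (c s') ≤ |s - s'| / fmax := by
    intro s s'
    have := hC (s / fmax) (s' / fmax)
    rwa [← sub_div, abs_div, abs_of_pos hmax] at this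
  set Δ := |q.1 - p.1| with hΔ
  obtain ⟨N, hN⟩ := exists_nat_gt ((L - Δ) / (t₁ - t₀))
  have hN0 : (0:ℝ) < N := lt_trans (div_pos (by linarith) (by linarith)) hN
  set h : ℝ := (L - Δ) / (2 * N) with hh
  have hh0 : 0 < h := div_pos (by linarith) (by linarith)
  have hNh : 2 * N * h = L - Δ := by rw [hh]; field_simp
  have hhs : h ≤ (t₁ - t₀) / 2 := by
    rw [div_lt_iff₀ (by linarith)] at hN
    rw [hh, div_le_iff₀ (by linarith)]
    linarith
  obtain ⟨σ, hσ, hσm⟩ : ∃ σ : ℝ, |σ| = h ∧ p.1 + σ ∈ Icc t₀ t₁ := by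
    obtain ⟨a1, a2⟩ := hp
    rcases le_total (p.1 + h) t₁ with hu | hu
    · exact ⟨h, abs_of_pos hh0, by linarith, hu⟩
    · exact ⟨-h, by rw [abs_neg, abs_of_pos hh0], by linarith, by linarith⟩
  set P : ℕ → ℝ × S := fun i => if i ≤ 2 * N then
    (if Even i then p.1 else p.1 + σ, c (i * h)) else q with hP
  have hstep : ∀ i < 2 * N, |(P (i+1)).1 - (P i).1| = h := by
    intro i hi
    simp only [hP, if_pos hi.le, if_pos (Nat.succ_le_of_lt hi)]
    by_cases he : Even i
    · have : ¬ Even (i+1) := by rw [Nat.even_add_one]; exact not_not.2 he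
      simp [he, this, hσ]
    · have : Even (i+1) := by rw [Nat.even_add_one]; exact he
      simp [he, this, hσ]
  have hPe : P (2 * N) = (p.1, c (2 * N * h)) := by
    simp [hP]
  have hPl : P (2 * N + 1) = q := by
    simp [hP]
  have hstr : ∀ i, (P i).1 ∈ Icc t₀ t₁ := by
    intro i
    simp only [hP]
    split_ifs
    · exact hp
    · exact hσm
    · exact hq
  refine ⟨⟨2 * N + 1, by omega, P, ?_, hPl, fun i _ => hstr i, ?_⟩, ?_⟩
  · simp [hP, hcdef, hC0]
  · intro i hi
    rcases Nat.lt_succ_iff_lt_or_eq.1 hi with hi | rfl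
    · refine causal_of_lip hfc hmin hbound hmax _ _ (hstr _) (hstr _) c hc (i * h) ((i+1 : ℕ) * h)
        ?_ ?_ ?_
      · simp [hP, hi.le]
      · simp only [hP, if_pos (Nat.succ_le_of_lt hi)]
      · rw [hstep i hi]; push_cast; ring
    · refine causal_of_lip hfc hmin hbound hmax _ _ (hstr _) (hstr _) c hc (2 * N * h) L
        ?_ ?_ ?_
      · rw [hPe]
      · rw [hPl, ← hC1]
      · rw [hPe, hPl, hNh]; simp only [hΔ]; ring
  · unfold nullLength
    simp only
    rw [Finset.sum_range_succ, Finset.sum_congr rfl (fun i hi => hstep i (Finset.mem_range.1 hi)),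
      hPe, hPl]
    simp only [Finset.sum_const, Finset.card_range, nsmul_eq_mul]
    push_cast
    rw [hNh]; simp only [hΔ]; ring

lemma nullDist_bounds (hLS : IsLengthSpace S) (hlt : t₀ < t₁)
    (hfc : ContinuousOn f (Icc t₀ t₁)) (hmin : 0 < fmin)
    (hbound : ∀ t ∈ Icc t₀ t₁, fmin ≤ f t ∧ f t ≤ fmax) 
    (p q : ℝ × S) (hp : p.1 ∈ Icc t₀ t₁) (hq : q.1 ∈ Icc t₀ t₁) :
    max |q.1 - p.1| (fmin * dist p.2 q.2) ≤ nullDist (tWarp f) (fun p => p.1) t₀ t₁ p q ∧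
    nullDist (tWarp f) (fun p => p.1) t₀ t₁ p q ≤ max |q.1 - p.1| (fmax * dist p.2 q.2) := by
  have hmax : 0 < fmax := hmin.trans_le ((hbound _ hp).1.trans (hbound _ hp).2)
  constructor
  · apply le_csInf
    · exact ⟨_, exists_curve hLS hlt hfc hmin hbound hmax p q hp hq _ (lt_add_one _)⟩
    · rintro _ ⟨γ, rfl⟩
      exact length_lower hfc hmin hbound p q γ
  · refine le_of_forall_gt_imp_ge_of_dense fun L hL => ?_
    refine csInf_le ⟨max |q.1 - p.1| (fmin * dist p.2 q.2), ?_⟩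
      (exists_curve hLS hlt hfc hmin hbound hmax p q hp hq L hL)
    rintro _ ⟨γ, rfl⟩
    exact length_lower hfc hmin hbound p q γ

lemma nullDist_degenerate (g : ℝ → S → ℝ) (t : ℝ) (p q : ℝ × S) :
    nullDist g (fun p => p.1) t t p q = 0 := by
  have hsub : ∀ L ∈ {L : ℝ | ∃ γ : PiecewiseCausal g t t p q, L = nullLength (fun p => p.1) γ},
      L = 0 := by
    rintro _ ⟨γ, rfl⟩
    unfold nullLength
    refine Finset.sum_eq_zero fun i hi => ?_
    have hi := Finset.mem_range.1 hi
    have a := γ.hstrip i hi.le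
    have b := γ.hstrip (i+1) hi
    rw [Icc_self, mem_singleton_iff] at a b
    simp [a, b]
  unfold nullDist
  exact le_antisymm (Real.sInf_nonpos fun L hL => (hsub L hL).le)
    (Real.sInf_nonneg fun L hL => (hsub L hL).ge)

end

end NDAux

/-- **Proposition 4.10 of Allen–Burtscher (`thm:biLip`).**
Let `(Σ,σ)` be a connected (continuous Riemannian, i.e. length) metric space
and `f : [t₀,t₁] → ℝ` bounded with `0 < f_min ≤ f(t) ≤ f_max < ∞`.  On
`M = [t₀,t₁] × Σ` consider `g_f = -dt² + f(t)²σ` and `g = -dt² + σ`.  Then for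
all `p,q ∈ M`,
`min{1,f_min}·d̂_{t,g}(p,q) ≤ d̂_{t,g_f}(p,q) ≤ max{1,f_max}·d̂_{t,g}(p,q)`. -/
theorem nullDist_warped_biLipschitz
    {S : Type*} [MetricSpace S] [ConnectedSpace S]
    (hLS : IsLengthSpace S)
    (t₀ t₁ : ℝ) (hle : t₀ ≤ t₁)
    (f : ℝ → ℝ) (hfc : ContinuousOn f (Set.Icc t₀ t₁))
    (fmin fmax : ℝ) (hmin : 0 < fmin)
    (hbound : ∀ t ∈ Set.Icc t₀ t₁, fmin ≤ f t ∧ f t ≤ fmax) :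
    ∀ p q : ℝ × S, p.1 ∈ Set.Icc t₀ t₁ → q.1 ∈ Set.Icc t₀ t₁ →
      min 1 fmin * nullDist (tWarp fun _ => (1:ℝ)) (fun p => p.1) t₀ t₁ p q ≤
        nullDist (tWarp f) (fun p => p.1) t₀ t₁ p q ∧
      nullDist (tWarp f) (fun p => p.1) t₀ t₁ p q ≤
        max 1 fmax * nullDist (tWarp fun _ => (1:ℝ)) (fun p => p.1) t₀ t₁ p q := by
  intro p q hp hq
  rcases hle.eq_or_lt with rfl | hlt
  · simp [NDAux.nullDist_degenerate]
  obtain ⟨a1, a2⟩ := NDAux.nullDist_bounds hLS hlt hfc hmin hbound p q hp hq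
  obtain ⟨b1, b2⟩ := NDAux.nullDist_bounds (f := fun _ => (1:ℝ)) (fmin := 1) (fmax := 1) hLS hlt
    continuousOn_const one_pos (fun _ _ => ⟨le_rfl, le_rfl⟩) p q hp hq
  rw [one_mul] at b1 b2
  have hd : 0 ≤ dist p.2 q.2 := dist_nonneg
  have hΔ : 0 ≤ |q.1 - p.1| := abs_nonneg _
  constructor
  · have hm : 0 ≤ min 1 fmin := le_min zero_le_one hmin.le
    refine (mul_le_mul_of_nonneg_left b2 hm).trans (le_trans ?_ a1)
    rw [mul_max_of_nonneg _ _ hm]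
    exact max_le_max (mul_le_of_le_one_left hΔ (min_le_left _ _))
      (mul_le_mul_of_nonneg_right (min_le_right _ _) hd)
  · have hm : 0 ≤ max 1 fmax := zero_le_one.trans (le_max_left _ _)
    refine le_trans (a2.trans ?_) (mul_le_mul_of_nonneg_left b1 hm)
    rw [mul_max_of_nonneg _ _ hm]
    exact max_le_max (le_mul_of_one_le_left hΔ (le_max_left _ _))
      (mul_le_mul_of_nonneg_right (le_max_right _ _) hd)
end

section
/- Let I be a closed interval and (Σ,σ) a connected compact Riemannian manifold. Suppose f_j : I → (0,∞) is a sequence of continuous functions uniformly bounded away from 0, with Lorentzian metrics g_j = −dt² + f_j(t)²σ on M = I × Σ. If f_j converges uniformly to a limit function f_∞, then the null distances d̂_{t,g_j} with respect to the canonical time function τ(t,x) = t converge uniformly to d̂_{t,g_∞} on M × M. -/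
open Set MeasureTheory Filter Topology

namespace NullDistPaper

variable {S : Type*} [PseudoMetricSpace S]

theorem aux_lip {S : Type*} [PseudoMetricSpace S] (hLS : IsLengthSpace S) (x y : S) (L : ℝ)
    (hL : dist x y < L) :
    ∃ h : ℝ → S, LipschitzWith 1 h ∧ h 0 = x ∧ ∀ s ≥ L, h s = y := by
  obtain ⟨γ, h0, h1, hc, hv⟩ := hLS x y ((L - dist x y)/2) (by linarith)
  have hLd : dist x y + (L - dist x y)/2 < L := by linarith
  have hpos : 0 ≤ dist x y + (L - dist x y)/2 := by
    have := dist_nonneg (x := x) (y := y); linarith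
  set B := dist x y + (L - dist x y)/2 with hB
  have hfin : ∀ t ∈ Icc (0:ℝ) 1, eVariationOn γ (Icc 0 t) ≠ ⊤ := by
    intro t ht
    have : eVariationOn γ (Icc 0 t) ≤ eVariationOn γ (Icc 0 1) :=
      eVariationOn.mono _ (Icc_subset_Icc le_rfl ht.2)
    exact ne_top_of_le_ne_top ENNReal.ofReal_ne_top (this.trans hv)
  set V : ℝ → ℝ := fun t => (eVariationOn γ (Icc 0 t)).toReal with hV
  have hVd : ∀ t ∈ Icc (0:ℝ) 1, ∀ u ∈ Icc (0:ℝ) 1, t ≤ u → dist (γ t) (γ u) ≤ V u - V t := by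
    intro t ht u hu htu
    have e := eVariationOn.Icc_add_Icc γ (s := univ) ht.1 htu (mem_univ _)
    simp only [univ_inter] at e
    have h2 : edist (γ t) (γ u) ≤ eVariationOn γ (Icc t u) :=
      eVariationOn.edist_le _ ⟨le_rfl, htu⟩ ⟨htu, le_rfl⟩
    have h3 : eVariationOn γ (Icc t u) ≠ ⊤ := by
      intro h; apply hfin u hu; rw [← e, h]; simp
    have h4 : V u = V t + (eVariationOn γ (Icc t u)).toReal := by
      simp only [hV]; rw [← e, ENNReal.toReal_add (hfin t ht) h3]
    rw [h4, dist_edist]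
    have := ENNReal.toReal_mono h3 h2
    linarith
  have hVm : ∀ t ∈ Icc (0:ℝ) 1, ∀ u ∈ Icc (0:ℝ) 1, t ≤ u → V t ≤ V u := by
    intro t ht u hu htu
    have := hVd t ht u hu htu
    have := dist_nonneg (x := γ t) (y := γ u); linarith
  have hV0 : 0 ≤ V 0 := ENNReal.toReal_nonneg
  have hV1 : V 1 < L := by
    have := ENNReal.toReal_mono ENNReal.ofReal_ne_top hv
    rw [ENNReal.toReal_ofReal hpos] at this
    exact lt_of_le_of_lt this hLd
  set A : ℝ → Set ℝ := fun s => {t | t ∈ Icc (0:ℝ) 1 ∧ (V t < s ∨ t = 0)} with hA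
  have hA0 : ∀ s, (0:ℝ) ∈ A s := fun s => ⟨by simp, Or.inr rfl⟩
  have hAb : ∀ s, BddAbove (A s) := fun s => ⟨1, fun t ht => ht.1.2⟩
  set φ : ℝ → ℝ := fun s => sSup (A s) with hφ
  have hφI : ∀ s, φ s ∈ Icc (0:ℝ) 1 := fun s =>
    ⟨le_csSup (hAb s) (hA0 s), csSup_le ⟨0, hA0 s⟩ (fun t ht => ht.1.2)⟩
  have hφm : ∀ s s', s ≤ s' → φ s ≤ φ s' := by
    intro s s' hs
    apply csSup_le_csSup (hAb s') ⟨0, hA0 s⟩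
    rintro t ⟨ht, h | h⟩
    · exact ⟨ht, Or.inl (h.trans_le hs)⟩
    · exact ⟨ht, Or.inr h⟩
  have key : ∀ s s', s ≤ s' → dist (γ (φ s)) (γ (φ s')) ≤ s' - s := by
    intro s s' hs
    rcases (hφm s s' hs).eq_or_lt with he | hlt
    · rw [he, dist_self]; linarith
    have hin : ∀ t u, φ s < t → t ≤ u → u < φ s' → dist (γ t) (γ u) ≤ s' - s := by
      intro t u h1 h2 h3
      have ht : t ∈ Icc (0:ℝ) 1 := ⟨(hφI s).1.trans h1.le, (h2.trans h3.le).trans (hφI s').2⟩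
      have hu : u ∈ Icc (0:ℝ) 1 := ⟨ht.1.trans h2, h3.le.trans (hφI s').2⟩
      have a1 : s ≤ V t := by
        by_contra hcon
        exact absurd (le_csSup (hAb s) (show t ∈ A s from ⟨ht, Or.inl (not_le.1 hcon)⟩)) (not_le.2 h1)
      obtain ⟨w, hw, huw⟩ := exists_lt_of_lt_csSup ⟨0, hA0 s'⟩ h3
      have a2 : V u ≤ s' := by
        rcases hw.2 with h | h
        · exact (hVm u hu w hw.1 huw.le).trans h.le
        · have := hu.1; linarith
      have := hVd t ht u hu h2
      linarith
    -- limits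
    obtain ⟨m, hm1, hm2⟩ := exists_between hlt
    have c1 : Tendsto γ (𝓝[Ioc (φ s) m] (φ s)) (𝓝 (γ (φ s))) :=
      ((hc (φ s) (hφI s)).mono (fun z hz => ⟨(hφI s).1.trans hz.1.le,
        (hz.2.trans hm2.le).trans (hφI s').2⟩)).tendsto
    have c2 : Tendsto γ (𝓝[Ico m (φ s')] (φ s')) (𝓝 (γ (φ s'))) :=
      ((hc (φ s') (hφI s')).mono (fun z hz => ⟨(hφI s).1.trans (hm1.le.trans hz.1),
        hz.2.le.trans (hφI s').2⟩)).tendsto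
    have : (𝓝[Ioc (φ s) m] (φ s)).NeBot := by
      rw [nhdsWithin_Ioc_eq_nhdsGT hm1]; infer_instance
    have : (𝓝[Ico m (φ s')] (φ s')).NeBot := by
      rw [nhdsWithin_Ico_eq_nhdsLT hm2]; infer_instance
    have d1 : ∀ t ∈ Ioc (φ s) m, dist (γ t) (γ (φ s')) ≤ s' - s := by
      intro t ht
      refine le_of_tendsto (tendsto_const_nhds.dist c2) ?_
      filter_upwards [self_mem_nhdsWithin] with u hu
      exact hin t u ht.1 (ht.2.trans hu.1) hu.2
    refine le_of_tendsto (c1.dist tendsto_const_nhds) ?_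
    filter_upwards [self_mem_nhdsWithin] with t ht
    exact d1 t ht
  refine ⟨fun s => γ (φ s), ?_, ?_, ?_⟩
  · apply LipschitzWith.of_dist_le_mul
    intro s s'
    rw [NNReal.coe_one, one_mul, Real.dist_eq]
    rcases le_total s s' with h | h
    · have := key s s' h
      rw [abs_sub_comm]; exact this.trans (le_abs_self _)
    · have := key s' s h
      rw [dist_comm]; exact this.trans (le_abs_self _)
  · have : φ 0 = 0 := by
      apply le_antisymm _ (hφI 0).1
      apply csSup_le ⟨0, hA0 0⟩
      rintro t ⟨ht, h | h⟩
      · have := hVm 0 (by simp) t ht ht.1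
        linarith
      · exact h.le
    simp only [this, h0]
  · intro s hs
    have : φ s = 1 := by
      apply le_antisymm (hφI s).2
      exact le_csSup (hAb s) ⟨by simp, Or.inl (hV1.trans_le hs)⟩
    simp only [this, h1]

theorem aux_intble {g : ℝ → ℝ} {t₀ t₁ c : ℝ} (hg : ContinuousOn g (Icc t₀ t₁)) (hc : 0 < c)
    (hgc : ∀ t ∈ Icc t₀ t₁, c ≤ g t) {a b : ℝ} (ha : a ∈ Icc t₀ t₁) (hb : b ∈ Icc t₀ t₁) :
    IntervalIntegrable (fun t => 1 / g t) volume a b := by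
  apply ContinuousOn.intervalIntegrable
  have hs : uIcc a b ⊆ Icc t₀ t₁ := uIcc_subset_Icc ha hb
  exact continuousOn_const.div (hg.mono hs) (fun t ht => (hc.trans_le (hgc t (hs ht))).ne')

theorem aux_future {S : Type*} [PseudoMetricSpace S] (hLS : IsLengthSpace S)
    {g : ℝ → ℝ} {t₀ t₁ c : ℝ} (hg : ContinuousOn g (Icc t₀ t₁)) (hc : 0 < c)
    (hgc : ∀ t ∈ Icc t₀ t₁, c ≤ g t) {a b : ℝ} (ha : a ∈ Icc t₀ t₁) (hb : b ∈ Icc t₀ t₁)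
    (hab : a ≤ b) (x y : S) (hxy : x = y ∨ dist x y < ∫ t in a..b, 1 / g t) :
    FutureRelated (tWarp g) (a, x) (b, y) := by
  obtain ⟨h, hl, h0, h1⟩ : ∃ h : ℝ → S, LipschitzWith 1 h ∧ h 0 = x ∧
      h (∫ t in a..b, 1 / g t) = y := by
    rcases hxy with rfl | hxy
    · exact ⟨fun _ => x, (LipschitzWith.const x).weaken (by simp), rfl, rfl⟩
    · obtain ⟨h, hl, h0, h1⟩ := aux_lip hLS x y _ hxy
      exact ⟨h, hl, h0, h1 _ le_rfl⟩
  set G : ℝ → ℝ := fun s => ∫ t in a..s, 1 / g t with hG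
  have hsub : Icc a b ⊆ Icc t₀ t₁ := Icc_subset_Icc ha.1 hb.2
  have hGd : ∀ u ∈ Icc a b, ∀ v ∈ Icc a b, G v - G u = ∫ t in u..v, 1 / g t := by
    intro u hu v hv
    exact intervalIntegral.integral_interval_sub_left
      (aux_intble hg hc hgc ha (hsub hv)) (aux_intble hg hc hgc ha (hsub hu))
  have hGm : MonotoneOn G (Icc a b) := by
    intro u hu v hv huv
    have := hGd u hu v hv
    have h2 : 0 ≤ ∫ t in u..v, 1 / g t := by
      apply intervalIntegral.integral_nonneg huv
      intro t ht
      have := hgc t (hsub ⟨hu.1.trans ht.1, ht.2.trans hv.2⟩)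
      exact one_div_nonneg.2 (hc.le.trans this)
    linarith
  refine ⟨hab, fun t => h (G t), by simp [hG, h0], h1, hab, ?_, ?_⟩
  · refine hl.continuous.comp_continuousOn ?_
    have := intervalIntegral.continuousOn_primitive_interval
      (μ := volume) (f := fun t => 1 / g t) (a := a) (b := b) (by
        have := (aux_intble hg hc hgc ha hb)
        rw [intervalIntegrable_iff'] at this
        exact this)
    rwa [uIcc_of_le hab] at this
  · intro u hu v hv huv
    have e1 := (hl.lipschitzOnWith (s := univ)).comp_eVariationOn_le
      (f := h) (g := G) (s := Icc u v) (fun _ _ => mem_univ _)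
    have e2 := (hGm.mono (Icc_subset_Icc hu.1 hv.2)).eVariationOn_eq
      (s := Icc u v) (a := u) (b := v) ⟨le_rfl, huv⟩ ⟨huv, le_rfl⟩
    rw [inter_self, hGd u hu v hv] at e2
    simp only [ENNReal.coe_one, one_mul] at e1
    exact e1.trans e2.le

/-- There is a piecewise causal curve from `p` to `q` of null length at most `l`. -/
def Reach {S : Type*} [PseudoMetricSpace S] (g : ℝ → ℝ) (t₀ t₁ : ℝ) (p q : ℝ × S) (l : ℝ) : Prop :=
  ∃ γ : PiecewiseCausal (tWarp g) t₀ t₁ p q, nullLength (fun p => p.1) γ ≤ l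

theorem Reach.mono {S : Type*} [PseudoMetricSpace S] {g : ℝ → ℝ} {t₀ t₁ : ℝ} {p q : ℝ × S}
    {l l' : ℝ} (h : Reach g t₀ t₁ p q l) (hl : l ≤ l') : Reach g t₀ t₁ p q l' := by
  obtain ⟨γ, h⟩ := h
  exact ⟨γ, h.trans hl⟩

theorem Reach.single {S : Type*} [PseudoMetricSpace S] {g : ℝ → ℝ} {t₀ t₁ : ℝ} {p q : ℝ × S}
    (hp : p.1 ∈ Icc t₀ t₁) (hq : q.1 ∈ Icc t₀ t₁) (h : CausallyRelated (tWarp g) p q) :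
    Reach g t₀ t₁ p q |q.1 - p.1| := by
  refine ⟨⟨1, one_pos, fun i => if i = 0 then p else q, by simp, by simp, ?_, ?_⟩, ?_⟩
  · intro i _
    split_ifs <;> assumption
  · intro i hi
    have : i = 0 := by omega
    subst this
    simpa using h
  · simp [nullLength]

theorem Reach.trans {S : Type*} [PseudoMetricSpace S] {g : ℝ → ℝ} {t₀ t₁ : ℝ} {p q r : ℝ × S}
    {l l' : ℝ} (h : Reach g t₀ t₁ p q l) (h' : Reach g t₀ t₁ q r l') :
    Reach g t₀ t₁ p r (l + l') := by
  obtain ⟨γ, h⟩ := h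
  obtain ⟨γ', h'⟩ := h'
  have e1 : ∀ i ≤ γ.k, (if i ≤ γ.k then γ.pt i else γ'.pt (i - γ.k)) = γ.pt i :=
    fun i hi => if_pos hi
  have e2 : ∀ i, (if γ.k + i ≤ γ.k then γ.pt (γ.k + i) else γ'.pt (γ.k + i - γ.k)) = γ'.pt i := by
    intro i
    rcases Nat.eq_zero_or_pos i with rfl | hi
    · simp [γ.hlast, γ'.h0]
    · rw [if_neg (by omega)]; congr 1; omega
  refine ⟨⟨γ.k + γ'.k, by have := γ.hk; omega,
    fun i => if i ≤ γ.k then γ.pt i else γ'.pt (i - γ.k), ?_, ?_, ?_, ?_⟩, ?_⟩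
  · simp [γ.h0]
  · exact (e2 _).trans γ'.hlast
  · intro i hi
    rcases le_total i γ.k with h | h
    · have := γ.hstrip i h
      simpa only [e1 i h] using this
    · obtain ⟨m, rfl⟩ := Nat.exists_eq_add_of_le h
      have := γ'.hstrip m (by omega)
      simpa only [e2] using this
  · intro i hi
    rcases lt_or_ge i γ.k with h | h
    · have := γ.piece i h
      simpa only [e1 i h.le, e1 (i+1) h] using this
    · obtain ⟨m, rfl⟩ := Nat.exists_eq_add_of_le h
      have := γ'.piece m (by omega)
      simpa only [add_assoc, e2] using this
  · refine le_trans (le_of_eq ?_) (add_le_add h h')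
    unfold nullLength
    dsimp only
    rw [Finset.sum_range_add]
    congr 1
    · apply Finset.sum_congr rfl
      intro i hi
      have hi := Finset.mem_range.1 hi
      rw [e1 i hi.le, e1 (i+1) hi]
    · apply Finset.sum_congr rfl
      intro i hi
      rw [add_assoc, e2, e2]

theorem aux_int_lower {g : ℝ → ℝ} {t₀ t₁ c M : ℝ} (hg : ContinuousOn g (Icc t₀ t₁)) (hc : 0 < c)
    (hgc : ∀ t ∈ Icc t₀ t₁, c ≤ g t) (hgM : ∀ t ∈ Icc t₀ t₁, g t ≤ M)
    {a b : ℝ} (ha : a ∈ Icc t₀ t₁) (hb : b ∈ Icc t₀ t₁) (hab : a ≤ b) :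
    (b - a) / M ≤ ∫ t in a..b, 1 / g t := by
  have : ∫ t in a..b, 1 / M ≤ ∫ t in a..b, 1 / g t := by
    apply intervalIntegral.integral_mono_on hab (by simp) (aux_intble hg hc hgc ha hb)
    intro t ht
    have ht' : t ∈ Icc t₀ t₁ := ⟨ha.1.trans ht.1, ht.2.trans hb.2⟩
    exact one_div_le_one_div_of_le (hc.trans_le (hgc t ht')) (hgM t ht')
  rw [intervalIntegral.integral_const, smul_eq_mul, mul_one_div] at this
  exact this

theorem aux_vert {S : Type*} [PseudoMetricSpace S] (hLS : IsLengthSpace S)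
    {g : ℝ → ℝ} {t₀ t₁ c : ℝ} (hg : ContinuousOn g (Icc t₀ t₁)) (hc : 0 < c)
    (hgc : ∀ t ∈ Icc t₀ t₁, c ≤ g t) {a b : ℝ} (ha : a ∈ Icc t₀ t₁) (hb : b ∈ Icc t₀ t₁) (x : S) :
    Reach g t₀ t₁ (a, x) (b, x) |b - a| := by
  apply Reach.single ha hb
  rcases le_total a b with h | h
  · exact Or.inl (aux_future hLS hg hc hgc ha hb h x x (Or.inl rfl))
  · exact Or.inr (aux_future hLS hg hc hgc hb ha h x x (Or.inl rfl))

theorem aux_diag {S : Type*} [PseudoMetricSpace S] (hLS : IsLengthSpace S)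
    {g : ℝ → ℝ} {t₀ t₁ c M : ℝ} (hg : ContinuousOn g (Icc t₀ t₁)) (hc : 0 < c)
    (hgc : ∀ t ∈ Icc t₀ t₁, c ≤ g t) (hgM : ∀ t ∈ Icc t₀ t₁, g t ≤ M)
    {a b : ℝ} (ha : a ∈ Icc t₀ t₁) (hb : b ∈ Icc t₀ t₁) (x y : S)
    (hxy : dist x y < |b - a| / M) :
    Reach g t₀ t₁ (a, x) (b, y) |b - a| := by
  apply Reach.single ha hb
  rcases le_total a b with h | h
  · refine Or.inl (aux_future hLS hg hc hgc ha hb h x y (Or.inr ?_))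
    rw [abs_of_nonneg (by linarith)] at hxy
    exact hxy.trans_le (aux_int_lower hg hc hgc hgM ha hb h)
  · refine Or.inr (aux_future hLS hg hc hgc hb ha h y x (Or.inr ?_))
    rw [abs_sub_comm, abs_of_nonneg (by linarith), dist_comm] at hxy
    exact hxy.trans_le (aux_int_lower hg hc hgc hgM hb ha h)

theorem aux_zigzag {S : Type*} [PseudoMetricSpace S] (hLS : IsLengthSpace S)
    {g : ℝ → ℝ} {t₀ t₁ c M : ℝ} (hlt : t₀ < t₁) (hg : ContinuousOn g (Icc t₀ t₁)) (hc : 0 < c)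
    (hgc : ∀ t ∈ Icc t₀ t₁, c ≤ g t) (hgM : ∀ t ∈ Icc t₀ t₁, g t ≤ M)
    {t : ℝ} (ht : t ∈ Icc t₀ t₁) (x y : S) (L : ℝ) (hL : dist x y < L) :
    Reach g t₀ t₁ (t, x) (t, y) (4 * M * L) := by
  obtain ⟨h, hl, h0, h1⟩ := aux_lip hLS x y L hL
  have hLpos : 0 < L := dist_nonneg.trans_lt hL
  have hM : 0 < M := hc.trans_le ((hgc t ht).trans (hgM t ht))
  obtain ⟨n, hn⟩ := exists_nat_gt (2 * M * L / ((t₁ - t₀) / 2))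
  have hd : 0 < (t₁ - t₀) / 2 := by linarith
  have hnpos : (0:ℝ) < n := lt_of_le_of_lt (by positivity) hn
  have hstep : 2 * M * L / n ≤ (t₁ - t₀) / 2 := by
    rw [div_lt_iff₀ hd] at hn
    rw [div_le_iff₀ hnpos]; linarith
  have hstep0 : 0 < 2 * M * L / n := by positivity
  obtain ⟨t', ht', htt⟩ : ∃ t' ∈ Icc t₀ t₁, |t' - t| = 2 * M * L / n := by
    rcases le_total t ((t₀ + t₁) / 2) with hh | hh
    · refine ⟨t + 2 * M * L / n, ⟨by linarith [ht.1], by linarith⟩, ?_⟩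
      rw [add_sub_cancel_left, abs_of_pos hstep0]
    · refine ⟨t - 2 * M * L / n, ⟨by linarith, by linarith [ht.2]⟩, ?_⟩
      rw [sub_sub_cancel_left, abs_neg, abs_of_pos hstep0]
  have main : ∀ i : ℕ, Reach g t₀ t₁ (t, x) (t, h (i * (L / n))) (i * (4 * M * L / n)) := by
    intro i
    induction i with
    | zero =>
      have := aux_vert hLS hg hc hgc ht ht x
      simpa [h0] using this
    | succ i ih =>
      have a1 : Reach g t₀ t₁ (t, h (i * (L / n))) (t', h ((i + 1 : ℕ) * (L / n))) |t' - t| := by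
        apply aux_diag hLS hg hc hgc hgM ht ht'
        have e := hl.dist_le_mul (i * (L / n)) ((i + 1 : ℕ) * (L / n))
        rw [NNReal.coe_one, one_mul, Real.dist_eq, abs_sub_comm] at e
        have : ((i + 1 : ℕ) * (L / n) - i * (L / n) : ℝ) = L / n := by push_cast; ring
        rw [this, abs_of_pos (by positivity)] at e
        refine e.trans_lt ?_
        rw [htt]
        have : 2 * M * L / n / M = 2 * (L / n) := by field_simp
        rw [this]
        have : 0 < L / n := by positivity
        linarith
      have a2 := aux_vert hLS hg hc hgc ht' ht (h ((i + 1 : ℕ) * (L / n)))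
      refine ((ih.trans a1).trans a2).mono (le_of_eq ?_)
      rw [abs_sub_comm t t', htt]; push_cast; ring
  have := main n
  have e : (n * (L / n) : ℝ) = L := by field_simp
  have e' : (n * (4 * M * L / n) : ℝ) = 4 * M * L := by field_simp
  rw [e, e', h1 L le_rfl] at this
  exact this

theorem aux_piece {S : Type*} [MetricSpace S] (hLS : IsLengthSpace S)
    {f g : ℝ → ℝ} {t₀ t₁ c M δ : ℝ} (hlt : t₀ < t₁) (hf : ContinuousOn f (Icc t₀ t₁))
    (hg : ContinuousOn g (Icc t₀ t₁)) (hc : 0 < c)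
    (hfc : ∀ t ∈ Icc t₀ t₁, c ≤ f t)
    (hgc : ∀ t ∈ Icc t₀ t₁, c ≤ g t) (hgM : ∀ t ∈ Icc t₀ t₁, g t ≤ M) (hδ : 0 < δ)
    (hfg : ∀ t ∈ Icc t₀ t₁, |f t - g t| ≤ δ)
    {a b : ℝ} (ha : a ∈ Icc t₀ t₁) (hb : b ∈ Icc t₀ t₁) (x y : S)
    (h : FutureRelated (tWarp f) (a, x) (b, y)) :
    Reach g t₀ t₁ (a, x) (b, y) ((1 + 4 * M * (1 / c ^ 2 + 3) * δ) * |b - a|) ∧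
    Reach g t₀ t₁ (b, y) (a, x) ((1 + 4 * M * (1 / c ^ 2 + 3) * δ) * |b - a|) := by
  obtain ⟨hab, w, hwx, hwy, -, -, hw⟩ := h
  dsimp only at hab hwx hwy hw
  have hd : dist x y ≤ ∫ t in a..b, 1 / f t := by
    have h1 := hw a ⟨le_rfl, hab⟩ b ⟨hab, le_rfl⟩ hab
    have h2 : edist (w a) (w b) ≤ eVariationOn w (Icc a b) :=
      eVariationOn.edist_le _ ⟨le_rfl, hab⟩ ⟨hab, le_rfl⟩
    rw [hwx, hwy, edist_dist] at h2
    have h3 := h2.trans h1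
    rwa [ENNReal.ofReal_le_ofReal_iff] at h3
    apply intervalIntegral.integral_nonneg hab
    intro t ht
    have := hfc t ⟨ha.1.trans ht.1, ht.2.trans hb.2⟩
    exact one_div_nonneg.2 (hc.le.trans this)
  rcases hab.eq_or_lt with rfl | hab'
  · rw [intervalIntegral.integral_same] at hd
    have : x = y := dist_le_zero.1 hd
    subst this
    have := aux_vert hLS hg hc hgc ha ha x
    simp only [sub_self, abs_zero, mul_zero] at this ⊢
    exact ⟨this, this⟩
  have hM : 0 < M := hc.trans_le ((hgc a ha).trans (hgM a ha))
  have hTg := aux_int_lower hg hc hgc hgM ha hb hab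
  have hTg0 : 0 < (b - a) / M := div_pos (by linarith) hM
  have hdiff : (∫ t in a..b, 1 / f t) - (∫ t in a..b, 1 / g t) ≤ δ / c ^ 2 * (b - a) := by
    rw [← intervalIntegral.integral_sub (aux_intble hf hc hfc ha hb) (aux_intble hg hc hgc ha hb)]
    have : ∫ t in a..b, (1 / f t - 1 / g t) ≤ ∫ t in a..b, δ / c ^ 2 := by
      apply intervalIntegral.integral_mono_on hab
        ((aux_intble hf hc hfc ha hb).sub (aux_intble hg hc hgc ha hb)) (by simp)
      intro t ht
      have ht' : t ∈ Icc t₀ t₁ := ⟨ha.1.trans ht.1, ht.2.trans hb.2⟩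
      have p1 := hfc t ht'
      have p2 := hgc t ht'
      have p3 := (abs_le.1 (hfg t ht')).1
      have q1 : 0 < f t := hc.trans_le p1
      have q2 : 0 < g t := hc.trans_le p2
      rw [div_sub_div _ _ q1.ne' q2.ne']
      apply div_le_div₀ hδ.le (by linarith) (by positivity)
      nlinarith
    rw [intervalIntegral.integral_const, smul_eq_mul, mul_comm] at this
    exact this
  set Tf := ∫ t in a..b, 1 / f t
  set Tg := ∫ t in a..b, 1 / g t with hTgdef
  have hba : 0 < b - a := by linarith
  have hδb : 0 < δ * (b - a) := by positivity
  obtain ⟨h, hl, h0, h1⟩ := aux_lip hLS x y (Tf + δ * (b - a)) (by linarith)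
  set s := max 0 (Tg - δ * (b - a)) with hs
  have hs0 : 0 ≤ s := le_max_left _ _
  have hsT : s < Tg := max_lt (by linarith) (by linarith)
  have hs2 : Tg - δ * (b - a) ≤ s := le_max_right _ _
  have hxz : dist x (h s) < Tg := by
    have e := hl.dist_le_mul 0 s
    rw [NNReal.coe_one, one_mul, Real.dist_eq, zero_sub, abs_neg, abs_of_nonneg hs0, h0] at e
    linarith
  have hR : 0 ≤ δ / c ^ 2 * (b - a) := by positivity
  have hzy : dist (h s) y < (1 / c ^ 2 + 3) * δ * (b - a) := by
    have e := hl.dist_le_mul s (max s (Tf + δ * (b - a)))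
    rw [NNReal.coe_one, one_mul, h1 _ (le_max_right _ _), Real.dist_eq, abs_sub_comm,
      abs_of_nonneg (sub_nonneg.2 (le_max_left _ _))] at e
    have e2 : (1 / c ^ 2 + 3) * δ * (b - a) = δ / c ^ 2 * (b - a) + 3 * (δ * (b - a)) := by ring
    have e3 : max s (Tf + δ * (b - a)) < s + (1 / c ^ 2 + 3) * δ * (b - a) := by
      apply max_lt <;> linarith
    linarith
  have r := aux_future hLS hg hc hgc ha hb hab x (h s) (Or.inr hxz)
  have z1 := aux_zigzag hLS hlt hg hc hgc hgM hb _ _ _ hzy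
  have z2 := aux_zigzag hLS hlt hg hc hgc hgM hb _ _ _ (by rw [dist_comm] at hzy; exact hzy)
  have s1 := Reach.single (g := g) (p := (a, x)) (q := (b, h s)) ha hb (Or.inl r)
  have s2 := Reach.single (g := g) (q := (a, x)) (p := (b, h s)) hb ha (Or.inr r)
  constructor
  · refine (s1.trans z1).mono (le_of_eq ?_)
    simp only [abs_of_pos hba]; ring
  · refine (z2.trans s2).mono (le_of_eq ?_)
    simp only [abs_sub_comm a b, abs_of_pos hba]; ring

theorem aux_path {S : Type*} [MetricSpace S] (hLS : IsLengthSpace S)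
    {f g : ℝ → ℝ} {t₀ t₁ c M δ : ℝ} (hlt : t₀ < t₁) (hf : ContinuousOn f (Icc t₀ t₁))
    (hg : ContinuousOn g (Icc t₀ t₁)) (hc : 0 < c)
    (hfc : ∀ t ∈ Icc t₀ t₁, c ≤ f t)
    (hgc : ∀ t ∈ Icc t₀ t₁, c ≤ g t) (hgM : ∀ t ∈ Icc t₀ t₁, g t ≤ M) (hδ : 0 < δ)
    (hfg : ∀ t ∈ Icc t₀ t₁, |f t - g t| ≤ δ) (p q : ℝ × S)
    (γ : PiecewiseCausal (tWarp f) t₀ t₁ p q) :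
    Reach g t₀ t₁ p q ((1 + 4 * M * (1 / c ^ 2 + 3) * δ) * nullLength (fun p => p.1) γ) := by
  have main : ∀ k ≤ γ.k, Reach g t₀ t₁ p (γ.pt k) ((1 + 4 * M * (1 / c ^ 2 + 3) * δ) *
      ∑ i ∈ Finset.range k, |(γ.pt (i + 1)).1 - (γ.pt i).1|) := by
    intro k
    induction k with
    | zero =>
      intro _
      have hp := γ.hstrip 0 (Nat.zero_le _)
      rw [γ.h0] at hp ⊢
      simpa using aux_vert hLS hg hc hgc hp hp p.2
    | succ k ih =>
      intro hk
      rw [Finset.sum_range_succ, mul_add]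
      refine (ih (by omega)).trans ?_
      have s1 := γ.hstrip k (by omega)
      have s2 := γ.hstrip (k + 1) hk
      rcases γ.piece k hk with h | h
      · exact (aux_piece hLS hlt hf hg hc hfc hgc hgM hδ hfg s1 s2 _ _ h).1
      · rw [abs_sub_comm]
        exact (aux_piece hLS hlt hf hg hc hfc hgc hgM hδ hfg s2 s1 _ _ h).2
  have := main γ.k le_rfl
  rw [γ.hlast] at this
  exact this

theorem nullLength_nn {S : Type*} [PseudoMetricSpace S] {g : ℝ → ℝ} {t₀ t₁ : ℝ} {p q : ℝ × S}
    (γ : PiecewiseCausal (tWarp g) t₀ t₁ p q) : 0 ≤ nullLength (fun p => p.1) γ :=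
  Finset.sum_nonneg fun _ _ => abs_nonneg _

theorem Reach.le {S : Type*} [PseudoMetricSpace S] {g : ℝ → ℝ} {t₀ t₁ : ℝ} {p q : ℝ × S} {l : ℝ}
    (h : Reach g t₀ t₁ p q l) : nullDist (tWarp g) (fun p => p.1) t₀ t₁ p q ≤ l := by
  obtain ⟨γ, h⟩ := h
  refine le_trans (csInf_le ⟨0, ?_⟩ ⟨γ, rfl⟩) h
  rintro _ ⟨γ, rfl⟩
  exact nullLength_nn γ

theorem aux_compare {S : Type*} [MetricSpace S] [CompactSpace S] (hLS : IsLengthSpace S)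
    {f g : ℝ → ℝ} {t₀ t₁ c M δ : ℝ} (hlt : t₀ < t₁) (hf : ContinuousOn f (Icc t₀ t₁))
    (hg : ContinuousOn g (Icc t₀ t₁)) (hc : 0 < c)
    (hfc : ∀ t ∈ Icc t₀ t₁, c ≤ f t) (hfM : ∀ t ∈ Icc t₀ t₁, f t ≤ M)
    (hgc : ∀ t ∈ Icc t₀ t₁, c ≤ g t) (hgM : ∀ t ∈ Icc t₀ t₁, g t ≤ M) (hδ : 0 < δ)
    (hfg : ∀ t ∈ Icc t₀ t₁, |f t - g t| ≤ δ) (p q : ℝ × S)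
    (hp : p.1 ∈ Icc t₀ t₁) (hq : q.1 ∈ Icc t₀ t₁) :
    nullDist (tWarp g) (fun p => p.1) t₀ t₁ p q - nullDist (tWarp f) (fun p => p.1) t₀ t₁ p q ≤
      (4 * M * (1 / c ^ 2 + 3)) * (t₁ - t₀ + 4 * M * (Metric.diam (univ : Set S) + 1)) * δ := by
  have hM : 0 < M := hc.trans_le ((hgc _ hp).trans (hgM _ hp))
  have hK : 0 < 4 * M * (1 / c ^ 2 + 3) := by positivity
  have hdm : dist p.2 q.2 ≤ Metric.diam (univ : Set S) :=
    Metric.dist_le_diam_of_mem isCompact_univ.isBounded (mem_univ _) (mem_univ _)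
  have hR : Reach f t₀ t₁ p q (t₁ - t₀ + 4 * M * (Metric.diam (univ : Set S) + 1)) := by
    have r1 := aux_vert hLS hf hc hfc hp hq p.2
    have r2 := aux_zigzag hLS hlt hf hc hfc hfM hq p.2 q.2 (Metric.diam (univ : Set S) + 1)
      (by linarith)
    refine (r1.trans r2).mono ?_
    gcongr
    rw [abs_le]; constructor <;> linarith [hp.1, hp.2, hq.1, hq.2]
  have hD := hR.le
  obtain ⟨γ₀, -⟩ := hR
  set K := 4 * M * (1 / c ^ 2 + 3) with hKdef
  have h1 : nullDist (tWarp g) (fun p => p.1) t₀ t₁ p q / (1 + K * δ) ≤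
      nullDist (tWarp f) (fun p => p.1) t₀ t₁ p q := by
    refine le_csInf ⟨_, γ₀, rfl⟩ ?_
    rintro _ ⟨γ, rfl⟩
    rw [div_le_iff₀ (by positivity), mul_comm]
    exact (aux_path hLS hlt hf hg hc hfc hgc hgM hδ hfg p q γ).le
  rw [div_le_iff₀ (by positivity)] at h1
  have h2 := mul_le_mul_of_nonneg_left hD (by positivity : 0 ≤ K * δ)
  nlinarith

theorem aux_degenerate {S : Type*} [PseudoMetricSpace S] (g : ℝ → ℝ) (t : ℝ) (p q : ℝ × S) :
    nullDist (tWarp g) (fun p => p.1) t t p q = 0 := by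
  have : {L : ℝ | ∃ γ : PiecewiseCausal (tWarp g) t t p q, L = nullLength (fun p => p.1) γ}
      ⊆ {0} := by
    rintro _ ⟨γ, rfl⟩
    apply Finset.sum_eq_zero
    intro i hi
    have hi := Finset.mem_range.1 hi
    have s1 := γ.hstrip i hi.le
    have s2 := γ.hstrip (i + 1) hi
    rw [Icc_self, mem_singleton_iff] at s1 s2
    simp [s1, s2]
  unfold nullDist
  rcases subset_singleton_iff_eq.1 this with h | h <;> simp [h]

end NullDistPaper

open NullDistPaper Set Filter

/-- **Theorem 5.1 of Allen–Burtscher (`thm:fuconv`).**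
Let `I = [t₀,t₁]` be a closed interval and `(Σ,σ)` a connected compact
(Riemannian, i.e. length) metric space.  Suppose `fⱼ : I → (0,∞)` are
continuous, uniformly bounded away from `0`, with Lorentzian metrics
`gⱼ = -dt² + fⱼ(t)²σ` on `M = I × Σ`.  If `fⱼ → f_∞` uniformly on `I`, then
the null distances `d̂_{t,gⱼ}` (w.r.t. the canonical time function
`τ(t,x) = t`) converge uniformly to `d̂_{t,g_∞}` on `M × M`. -/
theorem nullDist_uniform_convergence_of_uniform_convergence
    {S : Type*} [MetricSpace S] [CompactSpace S] [ConnectedSpace S]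
    (hLS : IsLengthSpace S)
    (t₀ t₁ : ℝ) (hle : t₀ ≤ t₁)
    (f : ℕ → ℝ → ℝ) (finf : ℝ → ℝ)
    (hfc : ∀ j, ContinuousOn (f j) (Set.Icc t₀ t₁))
    (c : ℝ) (hc : 0 < c) (hlower : ∀ j, ∀ t ∈ Set.Icc t₀ t₁, c ≤ f j t)
    (hunif : TendstoUniformlyOn (fun j t => f j t) finf atTop (Set.Icc t₀ t₁)) :
    ∀ ε > 0, ∃ N : ℕ, ∀ j ≥ N, ∀ p q : ℝ × S,
      p.1 ∈ Set.Icc t₀ t₁ → q.1 ∈ Set.Icc t₀ t₁ →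
      |nullDist (tWarp (f j)) (fun p => p.1) t₀ t₁ p q -
        nullDist (tWarp finf) (fun p => p.1) t₀ t₁ p q| ≤ ε := by
  intro ε hε
  rcases hle.eq_or_lt with rfl | hlt
  · refine ⟨0, fun j _ p q _ _ => ?_⟩
    rw [aux_degenerate, aux_degenerate]
    simpa using hε.le
  have hic : ContinuousOn finf (Icc t₀ t₁) :=
    hunif.continuousOn (Filter.Eventually.frequently (Filter.Eventually.of_forall hfc))
  have hilow : ∀ t ∈ Icc t₀ t₁, c ≤ finf t := fun t ht =>
    ge_of_tendsto (hunif.tendsto_at ht) (Filter.Eventually.of_forall fun j => hlower j t ht)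
  obtain ⟨M₀, hM₀⟩ := isCompact_Icc.exists_bound_of_continuousOn hic
  have hM1 : ∀ t ∈ Icc t₀ t₁, finf t ≤ M₀ := fun t ht => (le_abs_self _).trans (hM₀ t ht)
  have ht0 : t₀ ∈ Icc t₀ t₁ := ⟨le_rfl, hle⟩
  have hMpos : 0 < M₀ + 1 := by linarith [hM1 t₀ ht0, hilow t₀ ht0]
  set C := (4 * (M₀ + 1) * (1 / c ^ 2 + 3)) *
    (t₁ - t₀ + 4 * (M₀ + 1) * (Metric.diam (univ : Set S) + 1)) with hC
  have hCpos : 0 < C := by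
    have : 0 ≤ Metric.diam (univ : Set S) := Metric.diam_nonneg
    have : 0 < t₁ - t₀ := by linarith
    positivity
  have hδ : 0 < min 1 (ε / C) := lt_min one_pos (div_pos hε hCpos)
  obtain ⟨N, hN⟩ := Filter.eventually_atTop.1 (Metric.tendstoUniformlyOn_iff.1 hunif _ hδ)
  refine ⟨N, fun j hj p q hp hq => ?_⟩
  have hfg : ∀ t ∈ Icc t₀ t₁, |finf t - f j t| ≤ min 1 (ε / C) := fun t ht => (hN j hj t ht).le
  have hgf : ∀ t ∈ Icc t₀ t₁, |f j t - finf t| ≤ min 1 (ε / C) := fun t ht => by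
    rw [abs_sub_comm]; exact hfg t ht
  have hjM : ∀ t ∈ Icc t₀ t₁, f j t ≤ M₀ + 1 := fun t ht => by
    have h1 := (abs_le.1 (hgf t ht)).2
    have h2 := min_le_left 1 (ε / C)
    linarith [hM1 t ht]
  have hiM : ∀ t ∈ Icc t₀ t₁, finf t ≤ M₀ + 1 := fun t ht => by linarith [hM1 t ht]
  have hfin : C * min 1 (ε / C) ≤ ε := by
    have := mul_le_mul_of_nonneg_left (min_le_right 1 (ε / C)) hCpos.le
    rwa [mul_div_cancel₀ _ hCpos.ne'] at this
  have r1 := aux_compare hLS hlt hic (hfc j) hc hilow hiM (hlower j) hjM hδ hfg p q hp hq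
  have r2 := aux_compare hLS hlt (hfc j) hic hc (hlower j) hjM hilow hiM hδ hgf p q hp hq
  rw [abs_le]
  constructor <;> linarith
end
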